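/- Existence and uniqueness of the unit outward normal to the boundary: let 1 ≤ k ≤ n−1, let O ⊆ ℍ^n be open and let S ⊆ ℍ^n be a k-codimensional C¹_ℍ-regular submanifold with boundary in O. Then there exists a unique continuous unit outward-pointing vector field ν_{∂S} along O ∩ ∂S such that ν_{∂S}(p) ∈ T^ℍ_p S and ν_{∂S}(p) ⊥ T^ℍ_p ∂S for every p ∈ O ∩ ∂S (orthogonality with respect to the left-invariant inner product making X₁,…,Yₙ,T orthonormal). -/

import Mathlib

open MeasureTheory Topology Filter Set ENNReal

noncomputable section
namespace Heis

/-- Points of the `n`-th Heisenberg group `ℍⁿ ≡ ℝⁿ × ℝⁿ × ℝ`, `p = (x, y, t)`. -/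
abbrev Hpt (n : ℕ) : Type := (Fin n → ℝ) × (Fin n → ℝ) × ℝ

variable {n : ℕ}

/-- The Heisenberg group operation. -/
def hmul (p q : Hpt n) : Hpt n :=
  (p.1 + q.1, p.2.1 + q.2.1,
    p.2.2 + q.2.2 + (∑ j, p.1 j * q.2.1 j) / 2 - (∑ j, q.1 j * p.2.1 j) / 2)

/-- Group inverse. -/
def hinv (p : Hpt n) : Hpt n := (-p.1, -p.2.1, -p.2.2)

/-- Anisotropic dilations `δ_λ(x,y,t) = (λx, λy, λ²t)`. -/
def hdil (l : ℝ) (p : Hpt n) : Hpt n := (l • p.1, l • p.2.1, l ^ 2 * p.2.2)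

/-- The value at `p` of the `j`-th left invariant frame field `X₁,…,Xₙ,Y₁,…,Yₙ,T`,
expressed in the coordinates of `ℝ^{2n+1}`. -/
def frameVec (j : Fin (2*n+1)) (p : Hpt n) : Hpt n :=
  if h : (j : ℕ) < n then
    (Pi.single (⟨j, h⟩ : Fin n) 1, 0, -(p.2.1 ⟨j, h⟩) / 2)
  else if h' : (j : ℕ) < 2*n then
    (0, Pi.single (⟨(j:ℕ) - n, by omega⟩ : Fin n) 1, p.1 ⟨(j:ℕ) - n, by omega⟩ / 2)
  else (0, 0, 1)

/-- Inclusion of horizontal indices. -/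
def hIdx (j : Fin (2*n)) : Fin (2*n+1) := Fin.castLE (by omega) j

/-- Horizontal gradient `∇_ℍ f = (X₁f,…,Xₙf,Y₁f,…,Yₙf)` (pointwise derivatives along the
horizontal left-invariant fields). -/
def gradH (f : Hpt n → ℝ) (p : Hpt n) : Fin (2*n) → ℝ :=
  fun j => lineDeriv ℝ f p (frameVec (hIdx j) p)

/-- `f` is of class `C¹_ℍ` on `U`: it is continuous and its horizontal derivatives exist and
are (represented by) continuous functions on `U`. -/
structure IsC1H (U : Set (Hpt n)) (f : Hpt n → ℝ) : Prop where
  contOn : ContinuousOn f U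
  ldiff : ∀ p ∈ U, ∀ j : Fin (2*n), LineDifferentiableAt ℝ f p (frameVec (hIdx j) p)
  contGrad : ∀ j : Fin (2*n), ContinuousOn (fun p => gradH f p j) U

/-- Horizontal gradient as a frame-coefficient vector in `ℝ^{2n+1}` (with zero `T`-component). -/
def gradF (f : Hpt n → ℝ) (q : Hpt n) : Fin (2*n+1) → ℝ :=
  fun j => if h : (j:ℕ) < 2*n then gradH f q ⟨j, h⟩ else 0

/-- Horizontal derivative indexed by a natural number (0 outside the horizontal range). -/
def gradNat (f : Hpt n → ℝ) (q : Hpt n) (i : ℕ) : ℝ :=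
  if h : i < 2*n then gradH f q ⟨i, h⟩ else 0

/-- The Pansu differential of a `C¹_ℍ` function: `d_ℍf_p(x,y,t) = Σⱼ(xⱼXⱼf(p) + yⱼYⱼf(p))`. -/
def pansuD (f : Hpt n → ℝ) (p : Hpt n) (q : Hpt n) : ℝ :=
  ∑ j : Fin n, (q.1 j * gradH f p ⟨(j:ℕ), by omega⟩ + q.2.1 j * gradH f p ⟨n + (j:ℕ), by omega⟩)

/-- `S` is a `k`-codimensional `C¹_ℍ`-regular submanifold. -/
def IsC1HCodim (k : ℕ) (S : Set (Hpt n)) : Prop :=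
  ∀ p ∈ S, ∃ U : Set (Hpt n), IsOpen U ∧ p ∈ U ∧
    ∃ f : Fin k → Hpt n → ℝ,
      (∀ i, IsC1H U (f i)) ∧
      (∀ q ∈ U, LinearIndependent ℝ (fun i => gradH (f i) q)) ∧
      S ∩ U = {q ∈ U | ∀ i, f i q = 0}

/-- `L : ℝ^k → ℍⁿ` is a group homomorphism. -/
def IsGroupHomH {k : ℕ} (L : (Fin k → ℝ) → Hpt n) : Prop :=
  ∀ a b, L (a + b) = hmul (L a) (L b)

/-- Pansu differentiability of `f : ℝ^k → ℍⁿ` at `a`: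
`δ_{1/λ}(f(a)⁻¹ ⬝ f(a + λb)) → L(b)` locally uniformly in `b`, with `L` a group homomorphism. -/
def HasPansuDerivAt {k : ℕ} (f : (Fin k → ℝ) → Hpt n) (L : (Fin k → ℝ) → Hpt n)
    (a : Fin k → ℝ) : Prop :=
  IsGroupHomH L ∧
    TendstoLocallyUniformly
      (fun (l : ℝ) (b : Fin k → ℝ) => hdil l⁻¹ (hmul (hinv (f a)) (f (a + l • b)))) L (𝓝[>] 0)

/-- `S` is a `k`-dimensional (`k ≤ n`) `C¹_ℍ`-regular submanifold: locally the injective image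
of an open set of `ℝ^k` under a continuously Pansu differentiable map with injective
Pansu differential. -/
def IsC1HDim (k : ℕ) (S : Set (Hpt n)) : Prop :=
  ∀ p ∈ S, ∃ U : Set (Hpt n), IsOpen U ∧ p ∈ U ∧
    ∃ V : Set (Fin k → ℝ), IsOpen V ∧
    ∃ (f : (Fin k → ℝ) → Hpt n) (Df : (Fin k → ℝ) → (Fin k → ℝ) → Hpt n),
      Set.InjOn f V ∧ Set.MapsTo f V U ∧
      (∀ a ∈ V, HasPansuDerivAt f (Df a) a ∧ Function.Injective (Df a)) ∧
      (∀ b, ContinuousOn (fun a => Df a b) V) ∧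
      S ∩ U = f '' V

/-- `C¹_ℍ`-regular submanifold of codimension `k`, for any `1 ≤ k ≤ 2n+1` (for `k ≥ n+1` this
means a low-dimensional submanifold of dimension `2n+1-k`). -/
def IsC1HSub (k : ℕ) (S : Set (Hpt n)) : Prop :=
  if k ≤ n then IsC1HCodim k S else IsC1HDim (2*n+1-k) S

/-! ## Distances and measures -/

/-- Open ball of a distance function. -/
def rawBall (d : Hpt n → Hpt n → ℝ) (p : Hpt n) (r : ℝ) : Set (Hpt n) := {q | d p q < r}

/-- The gauge used to define the spherical Hausdorff measure of dimension `m` at scale `r`. -/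
def sphGauge (d : Hpt n → Hpt n → ℝ) (m r : ℝ) (s : Set (Hpt n)) : ℝ≥0∞ :=
  ⨅ (c : Hpt n) (ρ : ℝ) (_ : 0 < ρ) (_ : ρ < r) (_ : s ⊆ rawBall d c ρ),
    ENNReal.ofReal ((2*ρ) ^ m)

/-- Spherical pre-measure at scale `r`. -/
def sphPre (d : Hpt n → Hpt n → ℝ) (m r : ℝ) : OuterMeasure (Hpt n) :=
  OuterMeasure.boundedBy (sphGauge d m r)

/-- The spherical Hausdorff outer measure `𝒮^m` associated with `d`. -/
def sphOuter (d : Hpt n → Hpt n → ℝ) (m : ℝ) : OuterMeasure (Hpt n) :=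
  ⨆ (r : ℝ) (_ : 0 < r), sphPre d m r

/-- A left invariant, homogeneous, rotationally invariant distance on `ℍⁿ`.
(The field `carat` records the — automatically true — fact that Borel sets are
Carathéodory measurable for the associated spherical measures.) -/
structure HomDist (n : ℕ) where
  d : Hpt n → Hpt n → ℝ
  symm : ∀ p q, d p q = d q p
  triangle : ∀ p q r, d p r ≤ d p q + d q r
  eq_iff : ∀ p q, d p q = 0 ↔ p = q
  leftInv : ∀ g p q, d (hmul g p) (hmul g q) = d p q
  homog : ∀ l : ℝ, 0 < l → ∀ p q, d (hdil l p) (hdil l q) = l * d p q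
  rotInv : ∀ p q : Hpt n,
    (∑ j, (p.1 j ^ 2 + p.2.1 j ^ 2)) = (∑ j, (q.1 j ^ 2 + q.2.1 j ^ 2)) →
    p.2.2 = q.2.2 → d 0 p = d 0 q
  carat : ∀ m : ℝ,
    (inferInstance : MeasurableSpace (Hpt n)) ≤ (sphOuter d m).caratheodory

/-- Open ball `U(p,r)` of a homogeneous distance. -/
def hball (D : HomDist n) (p : Hpt n) (r : ℝ) : Set (Hpt n) := rawBall D.d p r

/-- The spherical Hausdorff measure `𝒮^m` of a homogeneous distance, as a measure. -/
def sphMeasure (D : HomDist n) (m : ℝ) : Measure (Hpt n) :=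
  (sphOuter D.d m).toMeasure (D.carat m)

/-- `μ⌊A` is locally finite on `O`. -/
def LocFin (μ : Measure (Hpt n)) (A O : Set (Hpt n)) : Prop :=
  ∀ p ∈ O, ∃ U : Set (Hpt n), IsOpen U ∧ p ∈ U ∧ μ (A ∩ U) < ⊤

/-! ## Euclidean coordinates and Euclidean Hausdorff measures -/

/-- Realization of a coordinate vector `c ∈ ℝ^{2n+1}` as a point/tangent vector of `ℍⁿ`. -/
def rE (c : Fin (2*n+1) → ℝ) : Hpt n :=
  (fun i => c ⟨(i:ℕ), by omega⟩, fun i => c ⟨n + (i:ℕ), by omega⟩, c ⟨2*n, by omega⟩)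

/-- Coordinates of a point/tangent vector of `ℍⁿ` as a vector of `ℝ^{2n+1}`. -/
def toEc (q : Hpt n) : Fin (2*n+1) → ℝ := fun j =>
  if h : (j:ℕ) < n then q.1 ⟨j, h⟩
  else if h' : (j:ℕ) < 2*n then q.2.1 ⟨(j:ℕ) - n, by omega⟩
  else q.2.2

/-- Identification of `ℍⁿ` with the Euclidean space `ℝ^{2n+1}`. -/
def ofE (q : EuclideanSpace ℝ (Fin (2*n+1))) : Hpt n := rE (fun j => q j)

/-- The `m`-dimensional Euclidean Hausdorff measure on `ℍⁿ ≡ ℝ^{2n+1}`. -/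
def muE (n : ℕ) (m : ℝ) : Measure (Hpt n) :=
  Measure.map ofE (μH[m] : Measure (EuclideanSpace ℝ (Fin (2*n+1))))

/-! ## Multivectors -/

/-- Index sets for a basis of `Λ_k 𝔥`. -/
def IdxSet (n k : ℕ) := {s : Finset (Fin (2*n+1)) // s.card = k}

instance (n k : ℕ) : Fintype (IdxSet n k) := by unfold IdxSet; infer_instance

/-- The increasing enumeration of an index set. -/
def idxTuple {k : ℕ} (s : IdxSet n k) (i : Fin k) : Fin (2*n+1) :=
  ((s.1.orderIsoOfFin s.2) i).1

/-- `k`-vectors, as coefficients with respect to the canonical basis of `Λ_k ℝ^{2n+1}`. -/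
abbrev MVec (n k : ℕ) := IdxSet n k → ℝ

/-- The simple `k`-vector `v₁ ∧ ⋯ ∧ v_k`. -/
def simpleWedge {k : ℕ} (v : Fin k → (Fin (2*n+1) → ℝ)) : MVec n k :=
  fun s => Matrix.det (Matrix.of fun i j => v i (idxTuple s j))

/-- Degree cast for multivectors. -/
def mvCast {a b : ℕ} (h : a = b) (t : MVec n a) : MVec n b :=
  fun s => t ⟨s.1, by rw [h]; exact s.2⟩

/-- Euclidean scalar product of coefficient vectors. -/
def dotC (a b : Fin (2*n+1) → ℝ) : ℝ := ∑ j, a j * b j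

/-- Pairing `⟨t | η⟩` at `p` of a `k`-vector (in the left invariant frame `X₁,…,Yₙ,T`)
with a `k`-form. -/
def pairF {k : ℕ} (t : MVec n k) (p : Hpt n) (η : (Fin k → Hpt n) → ℝ) : ℝ :=
  ∑ s, t s * η (fun i => frameVec (idxTuple s i) p)

/-- The `j`-th coordinate basis vector of `ℝ^{2n+1}`. -/
def coordC (j : Fin (2*n+1)) : Fin (2*n+1) → ℝ := fun j' => if j' = j then 1 else 0

/-- Pairing `⟨t | η⟩` of a `k`-vector (in the coordinate basis `∂x,∂y,∂t`) with a `k`-form. -/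
def pairE {k : ℕ} (t : MVec n k) (η : (Fin k → Hpt n) → ℝ) : ℝ :=
  ∑ s, t s * η (fun i => rE (coordC (idxTuple s i)))

/-- Realization of a frame-coefficient vector as a tangent vector at `p`. -/
def rF (c : Fin (2*n+1) → ℝ) (p : Hpt n) : Hpt n := ∑ j, c j • frameVec j p

/-! ## Covectors and Heisenberg forms -/

/-- `k`-covectors on `ℍⁿ`. -/
abbrev Cov (n k : ℕ) := AlternatingMap ℝ (Hpt n) ℝ (Fin k)

/-- Wedge product of covectors. -/
def cwedge {k l : ℕ} (α : Cov n k) (β : Cov n l) : Cov n (k + l) :=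
  AlternatingMap.domDomCongr finSumFinEquiv
    ((TensorProduct.lid ℝ ℝ).toLinearMap.compAlternatingMap (AlternatingMap.domCoprod α β))

/-- Degree cast for covectors. -/
def covCast {a b : ℕ} (h : a = b) (α : Cov n a) : Cov n b :=
  AlternatingMap.domDomCongr (finCongr h) α

def projX (j : Fin n) : Hpt n →ₗ[ℝ] ℝ := (LinearMap.proj j).comp (LinearMap.fst ℝ _ _)

def projY (j : Fin n) : Hpt n →ₗ[ℝ] ℝ :=
  (LinearMap.proj j).comp ((LinearMap.fst ℝ _ _).comp (LinearMap.snd ℝ _ _))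

def projT : Hpt n →ₗ[ℝ] ℝ := (LinearMap.snd ℝ _ _).comp (LinearMap.snd ℝ _ _)

/-- The contact form `θ = dt + ½Σⱼ(yⱼdxⱼ − xⱼdyⱼ)` at `p`, as a linear functional. -/
def thetaLin (p : Hpt n) : Hpt n →ₗ[ℝ] ℝ :=
  projT + (2:ℝ)⁻¹ • (∑ j : Fin n, (p.2.1 j • projX j - p.1 j • projY j))

/-- A linear functional as a `1`-covector. -/
def cov1 (L : Hpt n →ₗ[ℝ] ℝ) : Cov n 1 :=
  AlternatingMap.ofSubsingleton ℝ (Hpt n) ℝ (0 : Fin 1) L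

/-- `θ` as a `1`-covector. -/
def thetaC (p : Hpt n) : Cov n 1 := cov1 (thetaLin p)

/-- `dθ = −Σⱼ dxⱼ∧dyⱼ` as a (constant) `2`-covector. -/
def dthetaC : Cov n 2 := -∑ j : Fin n, cwedge (cov1 (projX j)) (cov1 (projY j))

/-- Membership in the Rumin ideal `ℐ^k = {λ∧θ + μ∧dθ}` at the point `p`. -/
def memI {k : ℕ} (p : Hpt n) (ω : Cov n k) : Prop :=
  ∃ (a : Cov n (k-1)) (ω₂ : Cov n k) (h1 : (k-1)+1 = k),
    ω = covCast h1 (cwedge a (thetaC p)) + ω₂ ∧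
    (ω₂ = 0 ∨ ∃ (b : Cov n (k-2)) (h2 : (k-2)+2 = k), ω₂ = covCast h2 (cwedge b dthetaC))

/-- Membership in `𝒥^k = {λ : λ∧θ = λ∧dθ = 0}` at the point `p`. -/
def memJ {k : ℕ} (p : Hpt n) (ω : Cov n k) : Prop :=
  cwedge ω (thetaC p) = 0 ∧ cwedge ω dthetaC = 0

/-- A compactly supported smooth Heisenberg `k`-form on `O` (for `k ≤ n` the values are
representatives of classes modulo `ℐ^k`; for `k ≥ n+1` they lie in `𝒥^k`). -/
structure IsHFormD (k : ℕ) (O : Set (Hpt n)) (ω : Hpt n → Cov n k) : Prop where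
  smooth : ∀ v : Fin k → Hpt n, ContDiff ℝ (⊤ : ℕ∞) fun p => ω p v
  cptSupp : ∃ K : Set (Hpt n), IsCompact K ∧ K ⊆ O ∧ ∀ p ∉ K, ω p = 0
  vert : n + 1 ≤ k → ∀ p, memJ p (ω p)

/-- Exterior derivative (as a raw multilinear expression):
`dω_p(v₀,…,v_k) = Σᵢ (−1)ⁱ ∂_{vᵢ}(q ↦ ω_q(v₀,…,v̂ᵢ,…,v_k))(p)`. -/
def extD {k : ℕ} (ω : Hpt n → Cov n k) (p : Hpt n) (v : Fin (k+1) → Hpt n) : ℝ :=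
  ∑ i : Fin (k+1), (-1 : ℝ)^(i:ℕ) * fderiv ℝ (fun q => ω q (v ∘ i.succAbove)) p (v i)

/-- `η` is the Rumin operator `D` applied to `ω` (only meaningful in degree `k = n`):
`Dω = d(ω − θ∧β)` where `β = L⁻¹((dω)_{𝔥₁})`, i.e. `β` is horizontal and `β∧dθ` agrees with
`dω` on horizontal vectors. -/
def IsRuminD {k : ℕ} (ω : Hpt n → Cov n k) (η : Hpt n → (Fin (k+1) → Hpt n) → ℝ) : Prop :=
  ∃ (β : Hpt n → Cov n (k-1)) (h1 : 1 + (k-1) = k) (h2 : (k-1)+2 = k+1),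
    (∀ v, ContDiff ℝ (⊤ : ℕ∞) fun p => β p v) ∧
    (∀ (p : Hpt n) (v : Fin (k-1) → Hpt n) (i : Fin (k-1)),
      v i = ((0:Fin n → ℝ), (0:Fin n → ℝ), (1:ℝ)) → β p v = 0) ∧
    (∀ (p : Hpt n) (v : Fin (k+1) → Hpt n), (∀ i, thetaLin p (v i) = 0) →
      extD ω p v = covCast h2 (cwedge (β p) dthetaC) v) ∧
    η = extD (fun p => ω p - covCast h1 (cwedge (thetaC p) (β p)))

/-- The Rumin differential `d_c`: the exterior derivative in degree `k ≠ n`, the second order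
operator `D` in the critical degree `k = n`. -/
def IsDc {k : ℕ} (ω : Hpt n → Cov n k) (η : Hpt n → (Fin (k+1) → Hpt n) → ℝ) : Prop :=
  if k = n then IsRuminD ω η else η = extD ω

/-- Degree cast for raw forms. -/
def rawCast {a b : ℕ} (h : a = b) (η : (Fin a → Hpt n) → ℝ) : (Fin b → Hpt n) → ℝ :=
  fun v => η (fun i => v (Fin.cast h i))

/-! ## Orientations and currents -/

/-- `t` is a unit tangent `m`-vector of the `k`-codimensional `C¹_ℍ` submanifold `S` at `p`,
i.e. `t = ±*n^ℍ_S(p)`: `t` is the wedge of an orthonormal basis of `ker d_ℍf_p`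
(in the left invariant frame). -/
def IsHTangentVecAt (k m : ℕ) (S : Set (Hpt n)) (p : Hpt n) (t : MVec n m) : Prop :=
  ∃ (U : Set (Hpt n)) (f : Fin k → Hpt n → ℝ), IsOpen U ∧ p ∈ U ∧
    (∀ i, IsC1H U (f i)) ∧
    (∀ q ∈ U, LinearIndependent ℝ (fun i => gradH (f i) q)) ∧
    S ∩ U = {q ∈ U | ∀ i, f i q = 0} ∧
    ∃ v : Fin m → (Fin (2*n+1) → ℝ),
      (∀ i j, dotC (v i) (v j) = if i = j then 1 else 0) ∧
      (∀ i l, dotC (v i) (gradF (f l) p) = 0) ∧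
      t = simpleWedge v

/-- An orientation of a `k`-codimensional `C¹_ℍ` submanifold: a continuous global choice of
the unit tangent `(2n+1−k)`-vector `t^ℍ_S` (here of formal degree `m`). -/
def IsHOrient (k m : ℕ) (S : Set (Hpt n)) (t : Hpt n → MVec n m) : Prop :=
  ContinuousOn t S ∧ ∀ p ∈ S, IsHTangentVecAt k m S p (t p)

/-- Classical Euclidean unit tangent `m`-vector at a point of an `m`-dimensional submanifold
(coefficients in the coordinate basis). -/
def IsEuclTangentVecAt (m : ℕ) (S : Set (Hpt n)) (p : Hpt n) (t : MVec n m) : Prop :=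
  ∃ v : Fin m → (Fin (2*n+1) → ℝ),
    (∀ i j, dotC (v i) (v j) = if i = j then 1 else 0) ∧
    (∀ i, rE (v i) ∈ tangentConeAt ℝ S p) ∧ t = simpleWedge v

/-- Classical (Euclidean) orientation of a low-dimensional submanifold. -/
def IsEuclOrient (m : ℕ) (S : Set (Hpt n)) (t : Hpt n → MVec n m) : Prop :=
  ContinuousOn t S ∧ ∀ p ∈ S, IsEuclTangentVecAt m S p (t p)

/-- The standard vertical subgroup `𝕎` of codimension `k`. -/
def Wstd (n k : ℕ) : Set (Hpt n) := {p | ∀ i : Fin n, (i:ℕ) < k → p.1 i = 0}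

/-- Embedding realizing `𝕎` as a Euclidean space. -/
def wEmbed (n k : ℕ) (a : ({i : Fin n // k ≤ (i:ℕ)} → ℝ) × (Fin n → ℝ) × ℝ) : Hpt n :=
  (fun i => if h : k ≤ (i:ℕ) then a.1 ⟨i, h⟩ else 0, a.2.1, a.2.2)

/-- Lebesgue measure `ℒ^{2n+1−k}` on the vertical subgroup `𝕎`. -/
def wLeb (n k : ℕ) : Measure (Hpt n) := Measure.map (wEmbed n k) volume

/-- The geometric constant
`C_{n,k} = (sup{ℒ^{2n+1−k}(𝕎 ∩ U(p,1)) : p ∈ U(0,1)})⁻¹`. -/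
def CnkC (D : HomDist n) (k : ℕ) : ℝ :=
  (sSup {v : ℝ | ∃ p ∈ hball D 0 1, v = (wLeb n k (Wstd n k ∩ hball D p 1)).toReal})⁻¹

/-- The Heisenberg current `⟦S⟧` of an oriented `k`-codimensional (`k ≤ n`) submanifold:
`⟦S⟧(ω) = (1/C_{n,k}) ∫_S ⟨t^ℍ_S | ω⟩ d𝒮^{Q−k}`. -/
def currF (D : HomDist n) (k : ℕ) (S : Set (Hpt n)) (t : Hpt n → MVec n (2*n+1-k))
    (η : Hpt n → (Fin (2*n+1-k) → Hpt n) → ℝ) : ℝ :=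
  (CnkC D k)⁻¹ * ∫ p in S, pairF (t p) p (η p) ∂(sphMeasure D ((2*n+2 : ℝ) - (k : ℝ)))

/-- The current of an oriented low-dimensional (`m ≤ n`) submanifold: the classical integral
`⟦S⟧(ω) = ∫_S ⟨τ_S | ω⟩ d𝓗^m_E`. -/
def currE {n : ℕ} (m : ℕ) (S : Set (Hpt n)) (t : Hpt n → MVec n m)
    (η : Hpt n → (Fin m → Hpt n) → ℝ) : ℝ :=
  ∫ p in S, pairE (t p) (η p) ∂(muE n (m : ℝ))

/-- The Heisenberg current of an oriented `m`-dimensional submanifold (any `m`). -/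
def hCurr (D : HomDist n) (m : ℕ) (S : Set (Hpt n)) (t : Hpt n → MVec n m)
    (η : Hpt n → (Fin m → Hpt n) → ℝ) : ℝ :=
  if m ≤ n then currE m S t η
  else if h2 : m ≤ 2*n+1 then
    currF D (2*n+1-m) S (fun p => mvCast (by omega) (t p)) (fun p => rawCast (by omega) (η p))
  else 0

/-- Orientation of an `m`-dimensional submanifold (any `m`): Euclidean in low dimension,
the continuous unit tangent field `t^ℍ_S` in low codimension. -/
def IsOrientS (m : ℕ) (S : Set (Hpt n)) (t : Hpt n → MVec n m) : Prop :=
  if m ≤ n then IsEuclOrient m S t else IsHOrient (2*n+1-m) m S t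

/-! ## Submanifolds with boundary -/

/-- The boundary `∂S = S̄ ∖ S`. -/
def bdry (S : Set (Hpt n)) : Set (Hpt n) := closure S \ S

/-- `S` is a `k`-codimensional `C¹_ℍ`-regular submanifold with boundary in `O`. -/
def IsC1HSubWithBdry (D : HomDist n) (k : ℕ) (O : Set (Hpt n)) (S : Set (Hpt n)) : Prop :=
  (O ∩ S).Nonempty ∧ IsC1HSub k (O ∩ S) ∧
  (O ∩ bdry S).Nonempty ∧ IsC1HSub (k+1) (O ∩ bdry S) ∧
  ∀ p ∈ O ∩ bdry S, ∃ U : Set (Hpt n), IsOpen U ∧ p ∈ U ∧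
    ∃ S' : Set (Hpt n), S' ⊆ U ∧ IsC1HSub k S' ∧ U ∩ closure S ⊆ S' ∧
      ∀ r : ℝ, 0 < r → (hball D p r ∩ (S' \ closure S)).Nonempty

/-- A family `f₁,…,f_{k+1}` of local defining functions at a boundary point `p`, as in the
characterization of `k`-codimensional submanifolds with boundary:
`U ∩ S = {f₁ = ⋯ = f_k = 0, f_{k+1} > 0}` and `f_{k+1}(p) = 0`. -/
def IsBdryFrame (k : ℕ) (S : Set (Hpt n)) (p : Hpt n) (U : Set (Hpt n))
    (f : Fin (k+1) → Hpt n → ℝ) : Prop :=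
  IsOpen U ∧ p ∈ U ∧ (∀ i, IsC1H U (f i)) ∧
  (∀ q ∈ U, LinearIndependent ℝ (fun i => gradH (f i) q)) ∧
  U ∩ S = {q ∈ U | (∀ i : Fin k, f i.castSucc q = 0) ∧ 0 < f (Fin.last k) q} ∧
  f (Fin.last k) p = 0

/-! ## Smooth and Euclidean submanifolds -/

/-- `S` is a smooth (Euclidean `C^∞`) submanifold of codimension `k`. -/
def IsSmoothCodim (k : ℕ) (S : Set (Hpt n)) : Prop :=
  ∀ p ∈ S, ∃ U : Set (Hpt n), IsOpen U ∧ p ∈ U ∧ ∃ f : Fin k → Hpt n → ℝ,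
    (∀ i, ContDiff ℝ (⊤ : ℕ∞) (f i)) ∧
    (∀ q ∈ U, LinearIndependent ℝ (fun i => fderiv ℝ (f i) q)) ∧
    S ∩ U = {q ∈ U | ∀ i, f i q = 0}

/-- `S` is a Euclidean `C¹` submanifold of codimension `k`. -/
def IsC1ECodim (k : ℕ) (S : Set (Hpt n)) : Prop :=
  ∀ p ∈ S, ∃ U : Set (Hpt n), IsOpen U ∧ p ∈ U ∧ ∃ f : Fin k → Hpt n → ℝ,
    (∀ i, ContDiff ℝ 1 (f i)) ∧
    (∀ q ∈ U, LinearIndependent ℝ (fun i => fderiv ℝ (f i) q)) ∧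
    S ∩ U = {q ∈ U | ∀ i, f i q = 0}

/-- `M` is a Euclidean `k`-dimensional `C¹` submanifold with boundary (`M` closed in its
charts; boundary charts are half-spaces). -/
def IsC1EuclSubWithBdryDim (k : ℕ) (M : Set (Hpt n)) : Prop :=
  ∀ p ∈ M, ∃ (V : Set (Fin k → ℝ)) (φ : (Fin k → ℝ) → Hpt n) (U : Set (Hpt n)) (a : Fin k → ℝ)
      (i₀ : Fin k),
    IsOpen V ∧ IsOpen U ∧ p ∈ U ∧ a ∈ V ∧ φ a = p ∧
    ContDiffOn ℝ 1 φ V ∧ Set.InjOn φ V ∧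
    (∀ b ∈ V, Function.Injective (fderivWithin ℝ φ V b)) ∧
    (M ∩ U = φ '' (V ∩ {x | 0 ≤ x i₀}) ∨ M ∩ U = φ '' V)

/-! ## Isometries -/

/-- A rotation of the horizontal layer: a linear group automorphism commuting with dilations,
preserving the vertical coordinate and the horizontal Euclidean norm. -/
def IsRotation (R : Hpt n → Hpt n) : Prop :=
  IsLinearMap ℝ R ∧ (∀ p q, R (hmul p q) = hmul (R p) (R q)) ∧
  (∀ l p, R (hdil l p) = hdil l (R p)) ∧
  (∀ p, (R p).2.2 = p.2.2) ∧
  (∀ p, (∑ j, ((R p).1 j ^ 2 + (R p).2.1 j ^ 2)) = ∑ j, (p.1 j ^ 2 + p.2.1 j ^ 2))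

/-- An isometry of `ℍⁿ`: the composition of a left translation and a rotation. -/
def IsHIsom (φ : Hpt n → Hpt n) : Prop :=
  ∃ (g : Hpt n) (R : Hpt n → Hpt n), IsRotation R ∧ φ = fun p => hmul g (R p)

/-! ## Tangent cones and blow-ups -/

/-- The tangent cone `T^ℍ_0 E` at the origin. -/
def tangentConeH (E : Set (Hpt n)) : Set (Hpt n) :=
  {x | ∃ (xh : ℕ → Hpt n) (rh : ℕ → ℝ), (∀ h, xh h ∈ E) ∧ Tendsto rh atTop atTop ∧
        Tendsto (fun h => hdil (rh h) (xh h)) atTop (𝓝 x)}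

/-- The tangent cone `T^ℍ_p E = T^ℍ_0(p⁻¹ ⬝ E)`. -/
def tangentConeHAt (E : Set (Hpt n)) (p : Hpt n) : Set (Hpt n) :=
  tangentConeH ((fun q => hmul (hinv p) q) '' E)

/-- Local Hausdorff convergence of the sets `F l` to `E` as `l → 0⁺`, with respect to the
homogeneous distance `D`. -/
def LocHausConv (D : HomDist n) (F : ℝ → Set (Hpt n)) (E : Set (Hpt n)) : Prop :=
  ∀ (c : Hpt n) (R ε : ℝ), 0 < R → 0 < ε → ∃ l0 : ℝ, 0 < l0 ∧ ∀ l : ℝ, 0 < l → l < l0 →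
    (∀ x ∈ F l ∩ {q | D.d c q ≤ R}, ∃ e ∈ E, D.d x e < ε) ∧
    (∀ x ∈ E ∩ {q | D.d c q ≤ R}, ∃ y ∈ F l, D.d x y < ε)

/-! ## Induced orientation on the boundary -/

/-- `tB` is the value at `p ∈ ∂S` of the orientation induced on `∂S` by the orientation `tS`
of the `m`-dimensional submanifold with boundary `S`. -/
def InducedBdryOrientAt (D : HomDist n) (m : ℕ) (S : Set (Hpt n)) (p : Hpt n)
    (tS : MVec n m) (tB : MVec n (m-1)) : Prop :=
  if m ≤ n then
    -- low dimension: classical Euclidean induced orientation via the outward normal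
    ∃ (νc : Fin (2*n+1) → ℝ) (w : Fin (m-1) → (Fin (2*n+1) → ℝ)) (h : (m-1)+1 = m),
      (∀ i j : Fin ((m-1)+1), dotC (Matrix.vecCons νc w i) (Matrix.vecCons νc w j) = if i = j then 1 else 0) ∧
      rE νc ∉ tangentConeAt ℝ (closure S) p ∧
      -(rE νc) ∈ tangentConeAt ℝ (closure S) p ∧
      (∀ i, rE (w i) ∈ tangentConeAt ℝ (bdry S) p) ∧
      tB = simpleWedge w ∧ tS = mvCast h (simpleWedge (Matrix.vecCons νc w))
  else if m = n+1 then
    -- critical codimension: `±T ∧ τ_{∂S} = t^ℍ_S` according to whether `S` lies below/above ∂S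
    ∃ (U : Set (Hpt n)) (f : Fin n → Hpt n → ℝ), IsOpen U ∧ p ∈ U ∧
      (∀ i, IsC1H U (f i)) ∧ (∀ q ∈ U, LinearIndependent ℝ (fun i => gradH (f i) q)) ∧
      U ∩ closure S ⊆ {q ∈ U | ∀ i, f i q = 0} ∧
      (∀ r : ℝ, 0 < r →
        (hball D p r ∩ ({q ∈ U | ∀ i, f i q = 0} \ closure S)).Nonempty) ∧
      ∃ (ε : ℝ) (w : Fin (m-1) → (Fin (2*n+1) → ℝ)) (h : (m-1)+1 = m),
        (ε = 1 ∨ ε = -1) ∧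
        (∀ i j, dotC (w i) (w j) = if i = j then 1 else 0) ∧
        (∀ i, w i ⟨2*n, by omega⟩ = 0) ∧
        (∀ i, rF (w i) p ∈ tangentConeAt ℝ (bdry S) p) ∧
        -- `ε = −1` iff `S` lies above its boundary around `p`:
        -- the blow-up of `S` at `p` is the corresponding open half of `T^ℍ_pS`
        LocHausConv D (fun l => (fun q => hdil l⁻¹ (hmul (hinv p) q)) '' S)
          ({v | ∀ i, pansuD (f i) p v = 0} ∩ {q | 0 < (-ε) * q.2.2}) ∧
        tB = simpleWedge (fun i => toEc (rF (w i) p)) ∧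
        tS = mvCast h (simpleWedge (Matrix.vecCons (fun j => if (j:ℕ) = 2*n then ε else 0) w))
  else
    -- non-critical low codimension: `ν_{∂S} ∧ t^ℍ_{∂S} = t^ℍ_S` with `ν` the outward normal
    ∃ (U : Set (Hpt n)) (f : Fin (2*n+1-m+1) → Hpt n → ℝ),
      IsBdryFrame (2*n+1-m) S p U f ∧
      ∃ (νc : Fin (2*n+1) → ℝ) (w : Fin (m-1) → (Fin (2*n+1) → ℝ)) (h : (m-1)+1 = m),
        (∀ i j : Fin ((m-1)+1), dotC (Matrix.vecCons νc w i) (Matrix.vecCons νc w j) = if i = j then 1 else 0) ∧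
        (∀ i : Fin (2*n+1-m), pansuD (f i.castSucc) p (rE νc) = 0) ∧
        pansuD (f (Fin.last (2*n+1-m))) p (rE νc) < 0 ∧
        (∀ i, ∀ l : Fin (2*n+1-m+1), pansuD (f l) p (rE (w i)) = 0) ∧
        tB = simpleWedge w ∧ tS = mvCast h (simpleWedge (Matrix.vecCons νc w))

/-! ## Miscellaneous -/

/-- The projection `π_p(q) = Σⱼ xⱼXⱼ(p) + Σⱼ yⱼYⱼ(p) ∈ H_pℍⁿ`. -/
def piProj (p q : Hpt n) : Hpt n :=
  (∑ j : Fin n, q.1 j • frameVec ⟨(j:ℕ), by omega⟩ p) +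
  (∑ j : Fin n, q.2.1 j • frameVec ⟨n + (j:ℕ), by omega⟩ p)

/-- The norm `|·|_p` on the horizontal fibre `H_pℍⁿ` making `X₁(p),…,Yₙ(p)` orthonormal. -/
def hnormAt (_p : Hpt n) (v : Hpt n) : ℝ :=
  Real.sqrt (∑ j, ((v.1 j) ^ 2 + (v.2.1 j) ^ 2))

/-- The left-invariant scalar product making `X₁,…,Yₙ,T` orthonormal. -/
def dotH (v w : Hpt n) : ℝ :=
  (∑ j, v.1 j * w.1 j) + (∑ j, v.2.1 j * w.2.1 j) + v.2.2 * w.2.2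
/-- `ν` is a continuous unit outward-pointing vector field along `O ∩ ∂S`, tangent to `S` and
orthogonal to `T^ℍ∂S` (with respect to the left-invariant scalar product making
`X₁,…,Yₙ,T` orthonormal). -/
def IsUnitOutwardNormal {n : ℕ} (k : ℕ) (O S : Set (Hpt n)) (ν : Hpt n → Hpt n) : Prop :=
  ContinuousOn ν (O ∩ bdry S) ∧
  ∀ p ∈ O ∩ bdry S,
    dotH (ν p) (ν p) = 1 ∧
    ∀ (U : Set (Hpt n)) (f : Fin (k+1) → Hpt n → ℝ), IsBdryFrame k S p U f →
      (∀ i : Fin k, pansuD (f i.castSucc) p (ν p) = 0) ∧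
      (∀ w : Hpt n, (∀ i : Fin (k+1), pansuD (f i) p w = 0) → dotH (ν p) w = 0) ∧
      pansuD (f (Fin.last k)) p (ν p) < 0

/-! ## Horizontal vectors and strict horizontal differentiability -/

/-- Horizontal vectors (coefficients with respect to `X₁,…,Yₙ`). -/
abbrev Hz (n : ℕ) : Type := (Fin n → ℝ) × (Fin n → ℝ)

def ex (h : Hz n) : Hpt n := (h.1, h.2, 0)

/-- Right translation of `q` by `exp h`. -/
def mv (q : Hpt n) (h : Hz n) : Hpt n := hmul q (ex h)

/-- The symplectic form. -/
def om (h h' : Hz n) : ℝ := (∑ j, h.1 j * h'.2 j) - ∑ j, h'.1 j * h.2 j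

def gz (f : Hpt n → ℝ) (p : Hpt n) : Hz n :=
  (fun j => gradH f p ⟨(j:ℕ), by omega⟩, fun j => gradH f p ⟨n + (j:ℕ), by omega⟩)

/-- The horizontal differential. -/
def dfl (f : Hpt n → ℝ) (p : Hpt n) : Hz n →ₗ[ℝ] ℝ where
  toFun h := ∑ j, (h.1 j * (gz f p).1 j + h.2 j * (gz f p).2 j)
  map_add' a b := by
    rw [← Finset.sum_add_distrib]
    exact Finset.sum_congr rfl fun j _ => by simp; ring
  map_smul' c a := by
    simp only [Prod.smul_fst, Prod.smul_snd, Pi.smul_apply, smul_eq_mul, RingHom.id_apply,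
      Finset.mul_sum]
    exact Finset.sum_congr rfl fun j _ => by ring

lemma pansuD_eq (f : Hpt n → ℝ) (p v : Hpt n) : pansuD f p v = dfl f p (v.1, v.2.1) := rfl

lemma mv_zero (q : Hpt n) : mv q 0 = q := by
  simp [mv, hmul, ex]

lemma mv_mv (q : Hpt n) (h h' : Hz n) (H : om h h' = 0) : mv (mv q h) h' = mv q (h + h') := by
  simp only [mv, hmul, ex, Prod.fst_add, Prod.snd_add, Pi.add_apply, add_zero, add_mul, mul_add,
    Finset.sum_add_distrib, Prod.mk.injEq, add_assoc, true_and]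
  unfold om at H
  linarith

lemma mv_pal (q : Hpt n) (a h : Hz n) : mv (mv (mv q a) h) a = mv q (a + h + a) := by
  have e1 : ∀ x y : Fin n → ℝ, ∑ j, x j * y j = ∑ j, y j * x j := fun x y =>
    Finset.sum_congr rfl fun j _ => mul_comm _ _
  simp only [mv, hmul, ex, Prod.fst_add, Prod.snd_add, Pi.add_apply, add_zero, add_mul, mul_add,
    Finset.sum_add_distrib, Prod.mk.injEq, add_assoc, true_and]
  ring

lemma continuous_mv : Continuous (fun x : Hpt n × Hz n => mv x.1 x.2) := by
  unfold mv hmul ex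
  fun_prop

/-- index of frame directions -/
def idx : Fin n ⊕ Fin n → Fin (2*n)
  | .inl j => ⟨(j:ℕ), by omega⟩
  | .inr j => ⟨n + (j:ℕ), by omega⟩

def co (h : Hz n) : Fin n ⊕ Fin n → ℝ
  | .inl j => h.1 j
  | .inr j => h.2 j

def bvec : Fin n ⊕ Fin n → Hz n
  | .inl j => (Pi.single j 1, 0)
  | .inr j => (0, Pi.single j 1)

lemma continuous_co (j : Fin n ⊕ Fin n) : Continuous (fun h : Hz n => co h j) := by
  cases j <;> simp only [co] <;> fun_prop

lemma co_le (h : Hz n) (j : Fin n ⊕ Fin n) : |co h j| ≤ ‖h‖ := by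
  cases j with
  | inl j => exact (norm_le_pi_norm h.1 j).trans (norm_fst_le h)
  | inr j => exact (norm_le_pi_norm h.2 j).trans (norm_snd_le h)

lemma sum_co (h : Hz n) : ∑ j, co h j • bvec j = h := by
  rw [Fintype.sum_sum_type]
  ext i
  · simp [co, bvec, Prod.fst_sum, Finset.sum_apply, Pi.single_apply]
  · simp [co, bvec, Prod.snd_sum, Finset.sum_apply, Pi.single_apply]

lemma dfl_eq (f : Hpt n → ℝ) (p : Hpt n) (h : Hz n) :
    dfl f p h = ∑ j, co h j * gradH f p (idx j) := by
  rw [Fintype.sum_sum_type]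
  simp [dfl, Finset.sum_add_distrib, co, gz, idx]

lemma mv_bvec (q : Hpt n) (j : Fin n ⊕ Fin n) (a : ℝ) :
    mv q (a • bvec j) = q + a • frameVec (hIdx (idx j)) q := by
  cases j with
  | inl j =>
    simp only [mv, hmul, ex, bvec, idx, hIdx, frameVec, Fin.castLE, Fin.is_lt]
    ext i
    · simp
    · simp
    · simp [Pi.single_apply]; ring
  | inr j =>
    simp only [mv, hmul, ex, bvec, idx, hIdx, frameVec, Fin.castLE]
    have h1 : ¬ (n + (j:ℕ) < n) := by omega
    have h2 : n + (j:ℕ) < 2 * n := by omega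
    simp only [h1, h2, dite_true, dite_false, Nat.add_sub_cancel_left]
    ext i
    · simp
    · simp
    · simp [Pi.single_apply]; ring

lemma frame_const (q : Hpt n) (j : Fin n ⊕ Fin n) (a : ℝ) :
    frameVec (hIdx (idx j)) (q + a • frameVec (hIdx (idx j)) q) = frameVec (hIdx (idx j)) q := by
  cases j with
  | inl j =>
    simp [idx, hIdx, frameVec, Fin.castLE]
  | inr j =>
    have h2 : n + (j:ℕ) < 2 * n := by omega
    simp [idx, hIdx, frameVec, Fin.castLE, h2]

lemma sdiff_base {U : Set (Hpt n)} (hU : IsOpen U) {f : Hpt n → ℝ} (hf : IsC1H U f) {p : Hpt n}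
    (hp : p ∈ U) (j : Fin n ⊕ Fin n) :
    (fun x : Hpt n × ℝ => f (mv x.1 (x.2 • bvec j)) - f x.1 - x.2 * gradH f p (idx j))
      =o[𝓝 (p, 0)] (fun x : Hpt n × ℝ => x.2) := by
  rw [Asymptotics.isLittleO_iff]
  intro ε hε
  have hc : Continuous (fun x : Hpt n × ℝ => mv x.1 (x.2 • bvec j)) :=
    continuous_mv.comp (continuous_fst.prodMk (continuous_snd.smul continuous_const))
  have hc0 : Tendsto (fun x : Hpt n × ℝ => mv x.1 (x.2 • bvec j)) (𝓝 (p, 0)) (𝓝 p) := by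
    have := hc.tendsto (p, 0)
    simpa [mv_zero] using this
  have hg : ContinuousAt (fun q => gradH f q (idx j)) p :=
    (hf.contGrad (idx j)).continuousAt (hU.mem_nhds hp)
  have e1 : ∀ᶠ q in 𝓝 p, q ∈ U ∧ |gradH f q (idx j) - gradH f p (idx j)| ≤ ε := by
    have := Metric.tendsto_nhds.1 hg ε hε
    filter_upwards [this, hU.mem_nhds hp] with q hq hqU
    exact ⟨hqU, le_of_lt hq⟩
  have e2 := hc0.eventually e1
  rw [nhds_prod_eq, Filter.eventually_prod_iff] at e2
  obtain ⟨P, hP, Q, hQ, hPQ⟩ := e2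
  obtain ⟨δ, hδ, hQδ⟩ := Metric.eventually_nhds_iff.1 hQ
  rw [nhds_prod_eq]
  refine Filter.Eventually.mono (hP.prod_mk (Metric.ball_mem_nhds (0:ℝ) hδ)) ?_
  rintro ⟨q, a⟩ ⟨hq, ha⟩
  simp only at hq ha ⊢
  set v := frameVec (hIdx (idx j)) q with hv
  have key : ∀ s : ℝ, |s| ≤ |a| → (q + s • v) ∈ U ∧
      |gradH f (q + s • v) (idx j) - gradH f p (idx j)| ≤ ε := by
    intro s hs
    have hs' : dist s 0 < δ := by
      have : dist a 0 < δ := ha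
      rw [Real.dist_0_eq_abs] at this ⊢
      exact lt_of_le_of_lt hs this
    have := hPQ hq (hQδ hs')
    simp only [mv_bvec] at this
    exact this
  have hder : ∀ s ∈ Icc (-|a|) |a|, HasDerivWithinAt
      (fun s : ℝ => f (q + s • v) - s * gradH f p (idx j))
      (gradH f (q + s • v) (idx j) - gradH f p (idx j)) (Icc (-|a|) |a|) s := by
    intro s hs
    have hs' : |s| ≤ |a| := abs_le.2 hs
    have h1 := (hf.ldiff _ (key s hs').1 (idx j)).hasLineDerivAt
    have h2 : frameVec (hIdx (idx j)) (q + s • v) = v := frame_const q j s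
    have h3 : lineDeriv ℝ f (q + s • v) (frameVec (hIdx (idx j)) (q + s • v)) =
      gradH f (q + s • v) (idx j) := rfl
    rw [h3, h2] at h1
    unfold HasLineDerivAt at h1
    have h4 : HasDerivAt (fun t : ℝ => f (q + t • v)) (gradH f (q + s • v) (idx j)) s := by
      have h5 : HasDerivAt (fun t : ℝ => t - s) 1 s := (hasDerivAt_id s).sub_const s
      have h6 : HasDerivAt (fun t : ℝ => f (q + s • v + t • v)) (gradH f (q + s • v) (idx j))
        (s - s) := by simpa using h1
      have h7 := HasDerivAt.comp (h := fun t : ℝ => t - s) s h6 h5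
      simp only [mul_one] at h7
      refine h7.congr_of_eventuallyEq (Eventually.of_forall fun t => ?_)
      simp only [Function.comp]
      congr 1
      rw [add_assoc, ← add_smul]; congr 2; ring
    have h8 := h4.sub ((hasDerivAt_id s).mul_const (gradH f p (idx j)))
    simp only [one_mul] at h8
    exact h8.hasDerivWithinAt
  have mvt := (convex_Icc (-|a|) |a|).norm_image_sub_le_of_norm_hasDerivWithin_le (C := ε) hder
    (fun s hs => by rw [Real.norm_eq_abs]; exact (key s (abs_le.2 hs)).2)
    (x := 0) (y := a) (by constructor <;> simp) (abs_le.1 le_rfl)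
  rw [mv_bvec]
  simp only [zero_smul, add_zero, zero_mul, sub_zero] at mvt
  have e : f (q + a • v) - f q - a * gradH f p (idx j) =
    f (q + a • v) - a * gradH f p (idx j) - f q := by ring
  rw [e]
  exact mvt

/-- Strict horizontal differentiability. -/
def SDiff (f : Hpt n → ℝ) (p : Hpt n) : Prop :=
  (fun x : Hpt n × Hz n => f (mv x.1 x.2) - f x.1 - dfl f p x.2)
      =o[𝓝 (p, 0)] (fun x : Hpt n × Hz n => x.2)

lemma sdiff_base' {U : Set (Hpt n)} (hU : IsOpen U) {f : Hpt n → ℝ} (hf : IsC1H U f) {p : Hpt n}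
    (hp : p ∈ U) (j : Fin n ⊕ Fin n) (γ : Hpt n × Hz n → Hpt n) (hγ : Tendsto γ (𝓝 (p, 0)) (𝓝 p)) :
    (fun x : Hpt n × Hz n => f (mv (γ x) ((co x.2 j / 2) • bvec j)) - f (γ x)
      - (co x.2 j / 2) * gradH f p (idx j))
      =o[𝓝 (p, 0)] (fun x : Hpt n × Hz n => x.2) := by
  have h0 : Tendsto (fun x : Hpt n × Hz n => (γ x, co x.2 j / 2)) (𝓝 (p, 0)) (𝓝 (p, 0)) := by
    refine hγ.prodMk_nhds ?_
    have : Continuous (fun x : Hpt n × Hz n => co x.2 j / 2) :=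
      ((continuous_co j).comp continuous_snd).div_const 2
    have h := this.tendsto (p, 0)
    have : co (0 : Hz n) j = 0 := by cases j <;> rfl
    simpa [this] using h
  refine ((sdiff_base hU hf hp j).comp_tendsto h0).trans_isBigO ?_
  refine Asymptotics.IsBigO.of_bound 1 (Eventually.of_forall fun x => ?_)
  simp only [Function.comp, Real.norm_eq_abs, abs_div, one_mul]
  have := co_le x.2 j
  have h2 : |(2:ℝ)| = 2 := by norm_num
  rw [h2]
  linarith [abs_nonneg (co x.2 j)]

lemma IsC1H.sdiff {U : Set (Hpt n)} (hU : IsOpen U) {f : Hpt n → ℝ} (hf : IsC1H U f) {p : Hpt n}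
    (hp : p ∈ U) : SDiff f p := by
  have main : ∀ s : Finset (Fin n ⊕ Fin n),
      ∀ γ : Hpt n × Hz n → Hpt n, Tendsto γ (𝓝 (p, 0)) (𝓝 p) →
      (fun x : Hpt n × Hz n => f (mv (γ x) (∑ j ∈ s, co x.2 j • bvec j)) - f (γ x)
        - ∑ j ∈ s, co x.2 j * gradH f p (idx j)) =o[𝓝 (p, 0)] (fun x : Hpt n × Hz n => x.2) := by
    intro s
    induction s using Finset.induction_on with
    | empty =>
      intro γ _
      simp [mv_zero]
    | insert j s hj ih =>
      intro γ hγ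
      have hstep : ∀ (γ : Hpt n × Hz n → Hpt n), Tendsto γ (𝓝 (p, 0)) (𝓝 p) →
          ∀ h : Hz n → Hz n, Continuous h → h 0 = 0 →
          Tendsto (fun x => mv (γ x) (h x.2)) (𝓝 (p, 0)) (𝓝 p) := by
        intro γ hγ h hh h0
        have : Tendsto (fun x : Hpt n × Hz n => (γ x, h x.2)) (𝓝 (p, 0)) (𝓝 (p, 0)) := by
          refine hγ.prodMk_nhds ?_
          have := (hh.comp continuous_snd).tendsto ((p, 0) : Hpt n × Hz n)
          simpa [h0, Function.comp_def] using this
        have h2 := (continuous_mv (n := n)).tendsto (p, 0)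
        simp only [mv_zero] at h2
        exact h2.comp this
      have c0 : ∀ j, co (0 : Hz n) j = 0 := by intro j; cases j <;> rfl
      have hγ1 := hstep γ hγ (fun h => (co h j / 2) • bvec j)
        (((continuous_co j).div_const 2).smul continuous_const) (by simp [c0])
      have hγ2 := hstep _ hγ1 (fun h => ∑ j ∈ s, co h j • bvec j)
        (continuous_finsetSum _ fun j _ => (continuous_co j).smul continuous_const) (by simp [c0])
      have a1 := sdiff_base' hU hf hp j γ hγ
      have a2 := ih _ hγ1
      have a3 := sdiff_base' hU hf hp j _ hγ2
      refine ((a1.add a2).add a3).congr_left fun x => ?_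
      rw [mv_pal, Finset.sum_insert hj, Finset.sum_insert hj]
      have : (co x.2 j / 2) • bvec j + ∑ j ∈ s, co x.2 j • bvec j + (co x.2 j / 2) • bvec j
        = co x.2 j • bvec j + ∑ j ∈ s, co x.2 j • bvec j := by
        rw [add_right_comm, ← add_smul]; congr 2; ring
      rw [this]
      ring
  have := main Finset.univ Prod.fst (continuous_fst.tendsto _)
  refine this.congr_left fun x => ?_
  rw [sum_co, dfl_eq]

/-! ## Linear algebra -/

lemma om_add_right (c a b : Hz n) : om c (a + b) = om c a + om c b := by
  simp only [om, Prod.fst_add, Prod.snd_add, Pi.add_apply, add_mul, mul_add,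
    Finset.sum_add_distrib]
  ring

lemma om_smul_right (c a : Hz n) (t : ℝ) : om c (t • a) = t * om c a := by
  simp only [om, Prod.smul_fst, Prod.smul_snd, Pi.smul_apply, smul_eq_mul, mul_sub,
    Finset.mul_sum]
  congr 1 <;> exact Finset.sum_congr rfl fun j _ => by ring

lemma om_skew (a b : Hz n) : om a b = - om b a := by
  simp only [om]; ring

lemma om_self (a : Hz n) : om a a = 0 := by
  simp only [om]; ring

lemma om_add_left (c a b : Hz n) : om (a + b) c = om a c + om b c := by
  rw [om_skew, om_add_right, om_skew c a, om_skew c b]; ring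

lemma om_smul_left (c a : Hz n) (t : ℝ) : om (t • a) c = t * om a c := by
  rw [om_skew, om_smul_right, om_skew c a]; ring

def omL (c : Hz n) : Hz n →ₗ[ℝ] ℝ where
  toFun := om c
  map_add' := om_add_right c
  map_smul' t a := om_smul_right c a t

def omR (c : Hz n) : Hz n →ₗ[ℝ] ℝ where
  toFun a := om a c
  map_add' a b := om_add_left c a b
  map_smul' t a := om_smul_left c a t

lemma om_nondeg (v : Hz n) (h : ∀ c, om c v = 0) : v = 0 := by
  have h1 := fun j : Fin n => h (Pi.single j 1, 0)
  have h2 := fun j : Fin n => h (0, Pi.single j 1)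
  simp only [om, Pi.single_apply, ite_mul, mul_ite, one_mul, mul_one, zero_mul, mul_zero,
    Finset.sum_ite_eq', Finset.mem_univ, if_true, Pi.zero_apply, Finset.sum_const_zero,
    sub_zero, zero_sub, neg_eq_zero] at h1 h2
  ext j
  · exact h2 j
  · exact h1 j

lemma iso_aux {m : ℕ} (a : Hz n →ₗ[ℝ] (Fin m → ℝ)) (ha : Function.Surjective a) :
    ∀ (d : ℕ) (L : (Fin m → ℝ) →ₗ[ℝ] Hz n), Function.Injective L →
      (∀ z w, om (L z) (L w) = 0) → Module.finrank ℝ (LinearMap.ker (a ∘ₗ L)) ≤ d →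
      ∃ L : (Fin m → ℝ) →ₗ[ℝ] Hz n, (∀ z w, om (L z) (L w) = 0) ∧
        Function.Bijective (a ∘ₗ L) := by
  intro d
  induction d with
  | zero =>
    intro L _ hiso hd
    refine ⟨L, hiso, ?_⟩
    have h1 : LinearMap.ker (a ∘ₗ L) = ⊥ := by
      apply Submodule.finrank_eq_zero.1; omega
    have h2 : Function.Injective (a ∘ₗ L) := LinearMap.ker_eq_bot.1 h1
    exact ⟨h2, LinearMap.injective_iff_surjective.1 h2⟩
  | succ d ih =>
    intro L hL hiso hd
    by_cases hk : LinearMap.ker (a ∘ₗ L) = ⊥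
    · have h2 : Function.Injective (a ∘ₗ L) := LinearMap.ker_eq_bot.1 hk
      exact ⟨L, hiso, h2, LinearMap.injective_iff_surjective.1 h2⟩
    obtain ⟨x, hx, hx0⟩ := Submodule.exists_mem_ne_zero_of_ne_bot hk
    have hns : ¬ Function.Surjective (a ∘ₗ L) := fun hs =>
      hk (LinearMap.ker_eq_bot.2 (LinearMap.injective_iff_surjective.2 hs))
    have hc : ∃ c : Hz n, a c ∉ LinearMap.range (a ∘ₗ L) ∧ om c (L x) ≠ 0 := by
      let p : Fin 2 → Submodule ℝ (Hz n) :=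
        ![(LinearMap.range (a ∘ₗ L)).comap a, LinearMap.ker (omR (L x))]
      have hp : ∀ i, p i ≠ ⊤ := by
        intro i
        fin_cases i
        · intro h
          apply hns
          intro y
          obtain ⟨c, rfl⟩ := ha y
          have : c ∈ (LinearMap.range (a ∘ₗ L)).comap a := by
            change c ∈ p 0
            rw [show p 0 = ⊤ from h]; trivial
          exact this
        · intro h
          apply hx0
          apply hL
          rw [map_zero]
          apply om_nondeg
          intro c
          have : c ∈ LinearMap.ker (omR (L x)) := by
            change c ∈ p 1
            rw [show p 1 = ⊤ from h]; trivial
          exact this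
      obtain ⟨c, hc⟩ := Submodule.exists_forall_notMem_of_forall_ne_top p hp
      exact ⟨c, hc 0, hc 1⟩
    obtain ⟨c, hc1, hc2⟩ := hc
    let L' : (Fin m → ℝ) →ₗ[ℝ] Hz n := L + ((omL c) ∘ₗ L).smulRight c
    have hL' : ∀ z, L' z = L z + om c (L z) • c := fun z => rfl
    refine ih L' ?_ ?_ ?_
    · rw [← LinearMap.ker_eq_bot, LinearMap.ker_eq_bot']
      intro z hz
      rw [hL'] at hz
      have h1 : om c (L z + om c (L z) • c) = 0 := by rw [hz]; simp [om]
      rw [om_add_right, om_smul_right, om_self, mul_zero, add_zero] at h1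
      rw [h1, zero_smul, add_zero] at hz
      exact hL (by rw [hz, map_zero])
    · intro z w
      rw [hL', hL', om_add_left, om_add_right, om_add_right, om_smul_left, om_smul_left,
        om_smul_right, om_smul_right, om_self, hiso, om_skew (L z) c]
      ring
    · have hlt : LinearMap.ker (a ∘ₗ L') < LinearMap.ker (a ∘ₗ L) := by
        have hz : ∀ z, z ∈ LinearMap.ker (a ∘ₗ L') → om c (L z) = 0 ∧ a (L z) = 0 := by
          intro z hz
          have h1 : a (L z) + om c (L z) • a c = 0 := by
            have : a (L' z) = 0 := hz
            rwa [hL', map_add, map_smul] at this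
          have h0 : om c (L z) = 0 := by
            by_contra h
            apply hc1
            refine ⟨(-(om c (L z))⁻¹) • z, ?_⟩
            rw [LinearMap.comp_apply, map_smul, map_smul, eq_neg_of_add_eq_zero_left h1, smul_neg,
              neg_smul, neg_neg, smul_smul, inv_mul_cancel₀ h, one_smul]
          rw [h0, zero_smul, add_zero] at h1
          exact ⟨h0, h1⟩
        refine lt_of_le_of_ne (fun z h => (hz z h).2) ?_
        intro h
        rw [← h] at hx
        exact hc2 (hz x hx).1
      have := Submodule.finrank_lt_finrank_of_lt hlt
      omega

lemma iso_exists {m : ℕ} (hm : m ≤ n) (a : Hz n →ₗ[ℝ] (Fin m → ℝ))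
    (ha : Function.Surjective a) :
    ∃ L : (Fin m → ℝ) →ₗ[ℝ] Hz n, (∀ z w, om (L z) (L w) = 0) ∧ ∀ z, a (L z) = z := by
  let L0 : (Fin m → ℝ) →ₗ[ℝ] Hz n :=
    { toFun := fun z => (fun i => if h : (i:ℕ) < m then z ⟨i, h⟩ else 0, 0)
      map_add' := by
        intro z w
        ext i
        · simp only [Pi.add_apply, Prod.fst_add]; split_ifs <;> simp
        · simp
      map_smul' := by
        intro t z
        ext i
        · simp
        · simp }
  obtain ⟨L, h1, h2⟩ := iso_aux a ha _ L0 (by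
    intro z w h
    ext i
    have := congrFun (congrArg Prod.fst h) ⟨(i:ℕ), by omega⟩
    simpa [L0] using this) (by intro z w; simp [om, L0]) le_rfl
  let A := LinearEquiv.ofBijective (a ∘ₗ L) h2
  refine ⟨L ∘ₗ A.symm.toLinearMap, fun z w => h1 _ _, fun z => ?_⟩
  exact A.apply_symm_apply z

/-- Euclidean product on horizontal vectors. -/
def hdot (h h' : Hz n) : ℝ := ∑ j, (h.1 j * h'.1 j + h.2 j * h'.2 j)

lemma dfl_hdot (f : Hpt n → ℝ) (p : Hpt n) (h : Hz n) : dfl f p h = hdot h (gz f p) := rfl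

lemma hdot_self {h : Hz n} (H : hdot h h = 0) : h = 0 := by
  unfold hdot at H
  rw [Finset.sum_eq_zero_iff_of_nonneg (fun j _ => add_nonneg (mul_self_nonneg (h.1 j))
    (mul_self_nonneg (h.2 j)))] at H
  ext j
  · have := H j (Finset.mem_univ j)
    simp only [Prod.fst_zero, Pi.zero_apply]
    nlinarith [mul_self_nonneg (h.1 j), mul_self_nonneg (h.2 j)]
  · have := H j (Finset.mem_univ j)
    simp only [Prod.snd_zero, Pi.zero_apply]
    nlinarith [mul_self_nonneg (h.1 j), mul_self_nonneg (h.2 j)]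

def gzL : (Fin (2*n) → ℝ) →ₗ[ℝ] Hz n where
  toFun g := (fun j => g ⟨(j:ℕ), by omega⟩, fun j => g ⟨n + (j:ℕ), by omega⟩)
  map_add' _ _ := rfl
  map_smul' _ _ := rfl

lemma gzL_inj : LinearMap.ker (gzL (n := n)) = ⊥ := by
  rw [LinearMap.ker_eq_bot']
  intro g hg
  ext i
  by_cases hi : (i:ℕ) < n
  · exact congrFun (congrArg Prod.fst hg) ⟨i, hi⟩
  · have := congrFun (congrArg Prod.snd hg) ⟨(i:ℕ) - n, by omega⟩
    simp only [gzL, LinearMap.coe_mk, AddHom.coe_mk, Prod.snd_zero, Pi.zero_apply] at this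
    have e : (⟨n + ((i:ℕ) - n), by omega⟩ : Fin (2*n)) = i := by
      ext
      simp only
      omega
    rw [e] at this
    exact this

lemma gz_indep {m : ℕ} (F : Fin m → Hpt n → ℝ) (p : Hpt n) :
    LinearIndependent ℝ (fun i => gz (F i) p) ↔ LinearIndependent ℝ (fun i => gradH (F i) p) :=
  LinearMap.linearIndependent_iff (v := fun i => gradH (F i) p) gzL gzL_inj

def gram {m : ℕ} (F : Fin m → Hpt n → ℝ) (p : Hpt n) : Matrix (Fin m) (Fin m) ℝ :=
  Matrix.of fun i j => dfl (F i) p (gz (F j) p)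

lemma gram_mulVec {m : ℕ} (F : Fin m → Hpt n → ℝ) (p : Hpt n) (c : Fin m → ℝ) (i : Fin m) :
    (gram F p).mulVec c i = dfl (F i) p (∑ j, c j • gz (F j) p) := by
  simp only [gram, Matrix.mulVec, dotProduct, Matrix.of_apply, map_sum, map_smul, smul_eq_mul]
  exact Finset.sum_congr rfl fun j _ => mul_comm _ _

lemma hdot_comb {m : ℕ} (F : Fin m → Hpt n → ℝ) (p : Hpt n) (c : Fin m → ℝ) (w : Hz n) :
    hdot w (∑ j, c j • gz (F j) p) = ∑ j, c j * dfl (F j) p w := by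
  simp only [dfl_hdot, hdot, Prod.fst_sum, Prod.snd_sum, Finset.sum_apply, Prod.smul_fst,
    Prod.smul_snd, Pi.smul_apply, smul_eq_mul, Finset.mul_sum]
  rw [Finset.sum_comm]
  refine Finset.sum_congr rfl fun j _ => ?_
  rw [← Finset.sum_add_distrib]
  exact Finset.sum_congr rfl fun j _ => by ring

lemma gram_det {m : ℕ} {F : Fin m → Hpt n → ℝ} {p : Hpt n}
    (h : LinearIndependent ℝ (fun i => gradH (F i) p)) : (gram F p).det ≠ 0 := by
  rw [← gz_indep] at h
  intro h0
  obtain ⟨c, hc, hc0⟩ := Matrix.exists_mulVec_eq_zero_iff.2 h0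
  apply hc
  have h1 : ∀ i, dfl (F i) p (∑ j, c j • gz (F j) p) = 0 := fun i => by
    rw [← gram_mulVec, hc0]; rfl
  have h2 : hdot (∑ j, c j • gz (F j) p) (∑ j, c j • gz (F j) p) = 0 := by
    rw [hdot_comb]
    exact Finset.sum_eq_zero fun i _ => by rw [h1, mul_zero]
  have h3 := hdot_self h2
  ext i
  exact Fintype.linearIndependent_iff.1 h c h3 i

def dall {m : ℕ} (F : Fin m → Hpt n → ℝ) (p : Hpt n) : Hz n →ₗ[ℝ] (Fin m → ℝ) :=
  LinearMap.pi fun i => dfl (F i) p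

lemma dall_surj {m : ℕ} {F : Fin m → Hpt n → ℝ} {p : Hpt n}
    (h : LinearIndependent ℝ (fun i => gradH (F i) p)) : Function.Surjective (dall F p) := by
  intro c
  have hd := gram_det h
  refine ⟨∑ j, ((gram F p)⁻¹.mulVec c) j • gz (F j) p, ?_⟩
  ext i
  change dfl (F i) p _ = _
  rw [← gram_mulVec, Matrix.mulVec_mulVec, Matrix.mul_nonsing_inv _ (isUnit_iff_ne_zero.2 hd),
    Matrix.one_mulVec]

/-! ## Quantitative implicit function theorem along isotropic cosets -/

def Fv {m : ℕ} (F : Fin m → Hpt n → ℝ) (q : Hpt n) : Fin m → ℝ := fun i => F i q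

lemma cont_mvL {m : ℕ} (L : (Fin m → ℝ) →ₗ[ℝ] Hz n) :
    Continuous (fun x : Hpt n × (Fin m → ℝ) => mv x.1 (L x.2)) :=
  continuous_mv.comp (continuous_fst.prodMk
    ((LinearMap.continuous_of_finiteDimensional L).comp continuous_snd))

lemma est {m : ℕ} {F : Fin m → Hpt n → ℝ} {p : Hpt n} (hF : ∀ i, SDiff (F i) p)
    (L : (Fin m → ℝ) →ₗ[ℝ] Hz n) (hiso : ∀ z w, om (L z) (L w) = 0)
    (hL : ∀ z, dall F p (L z) = z) :
    ∃ ε > 0, ∀ᶠ q in 𝓝 p, ∀ z z' : Fin m → ℝ, ‖z‖ < ε → ‖z'‖ < ε →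
      ‖Fv F (mv q (L z)) - Fv F (mv q (L z')) - (z - z')‖ ≤ 1/2 * ‖z - z'‖ := by
  have hLc : Continuous L := LinearMap.continuous_of_finiteDimensional L
  have hT : Tendsto (fun x : Hpt n × ((Fin m → ℝ) × (Fin m → ℝ)) =>
      (mv x.1 (L x.2.2), L (x.2.1 - x.2.2))) (𝓝 (p, (0, 0))) (𝓝 (p, 0)) := by
    have hc : Continuous (fun x : Hpt n × ((Fin m → ℝ) × (Fin m → ℝ)) =>
      (mv x.1 (L x.2.2), L (x.2.1 - x.2.2))) :=
      ((cont_mvL L).comp (continuous_fst.prodMk (continuous_snd.comp continuous_snd))).prodMk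
        (hLc.comp ((continuous_fst.comp continuous_snd).sub (continuous_snd.comp continuous_snd)))
    have := hc.tendsto (p, (0, 0))
    simpa [mv_zero] using this
  have hO : (fun x : Hpt n × ((Fin m → ℝ) × (Fin m → ℝ)) => L (x.2.1 - x.2.2))
      =O[𝓝 (p, (0, 0))] (fun x => x.2.1 - x.2.2) :=
    (L.toContinuousLinearMap.isBigO_comp (fun x : Hpt n × ((Fin m → ℝ) × (Fin m → ℝ)) =>
      x.2.1 - x.2.2) _)
  have h1 : ∀ᶠ x : Hpt n × ((Fin m → ℝ) × (Fin m → ℝ)) in 𝓝 (p, (0, 0)),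
      ∀ i, ‖F i (mv x.1 (L x.2.1)) - F i (mv x.1 (L x.2.2)) - (x.2.1 - x.2.2) i‖ ≤
        1/2 * ‖x.2.1 - x.2.2‖ := by
    rw [eventually_all]
    intro i
    have h2 := (((hF i).comp_tendsto hT).trans_isBigO hO)
    have h3 := (Asymptotics.isLittleO_iff.1 h2) (c := 1/2) (by norm_num)
    filter_upwards [h3] with x hx
    simp only [Function.comp] at hx
    rw [mv_mv _ _ _ (hiso _ _), ← map_add, add_sub_cancel] at hx
    have h4 : dfl (F i) p (L (x.2.1 - x.2.2)) = (x.2.1 - x.2.2) i :=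
      congrFun (hL (x.2.1 - x.2.2)) i
    rwa [h4] at hx
  rw [nhds_prod_eq, Filter.eventually_prod_iff] at h1
  obtain ⟨P, hP, Q, hQ, hPQ⟩ := h1
  obtain ⟨ε, hε, hQε⟩ := Metric.eventually_nhds_iff.1 hQ
  refine ⟨ε, hε, hP.mono fun q hq z z' hz hz' => ?_⟩
  have hd : dist (z, z') ((0 : Fin m → ℝ), (0 : Fin m → ℝ)) < ε := by
    rw [Prod.dist_eq, max_lt_iff]
    simpa using ⟨hz, hz'⟩
  rw [pi_norm_le_iff_of_nonneg (by positivity)]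
  intro i
  exact hPQ hq (hQε hd) i

lemma est2 {m : ℕ} {F : Fin m → Hpt n → ℝ} {p : Hpt n} (hF : ∀ i, SDiff (F i) p)
    (L : (Fin m → ℝ) →ₗ[ℝ] Hz n) (hiso : ∀ z w, om (L z) (L w) = 0)
    (hL : ∀ z, dall F p (L z) = z) :
    ∃ ε > 0, ∀ᶠ q in 𝓝 p,
      (∀ z z' : Fin m → ℝ, ‖z‖ < ε → ‖z'‖ < ε →
        ‖z - z'‖ ≤ 2 * ‖Fv F (mv q (L z)) - Fv F (mv q (L z'))‖) ∧
      (∀ c : Fin m → ℝ, 2 * ‖c - Fv F q‖ < ε → ∃ z, ‖z‖ ≤ 2 * ‖c - Fv F q‖ ∧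
        Fv F (mv q (L z)) = c) := by
  obtain ⟨ε, hε, h⟩ := est hF L hiso hL
  refine ⟨ε, hε, h.mono fun q hq => ⟨fun z z' hz hz' => ?_, fun c hc => ?_⟩⟩
  · have h1 := hq z z' hz hz'
    have h2 := norm_sub_norm_le (z - z') (Fv F (mv q (L z)) - Fv F (mv q (L z')))
    rw [norm_sub_rev (z - z')] at h2
    linarith
  · have hA : ApproximatesLinearOn (fun z => Fv F (mv q (L z)))
        ((ContinuousLinearEquiv.refl ℝ (Fin m → ℝ) : (Fin m → ℝ) →L[ℝ] (Fin m → ℝ)))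
        (Metric.ball 0 ε) (1/2) := by
      intro z hz z' hz'
      have := hq z z' (by simpa using hz) (by simpa using hz')
      simpa using this
    let fs : ((ContinuousLinearEquiv.refl ℝ (Fin m → ℝ) :
        (Fin m → ℝ) →L[ℝ] (Fin m → ℝ))).NonlinearRightInverse :=
      { toFun := id
        nnnorm := 1
        bound' := by intro y; simp
        right_inv' := by intro y; simp }
    have hs := hA.surjOn_closedBall_of_nonlinearRightInverse fs (ε := 2 * ‖c - Fv F q‖) (b := 0)
      (by positivity) (Metric.closedBall_subset_ball hc)
    have hmem : c ∈ Metric.closedBall ((fun z => Fv F (mv q (L z))) 0)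
        (((fs.nnnorm : ℝ)⁻¹ - ((1/2 : NNReal) : ℝ)) * (2 * ‖c - Fv F q‖)) := by
      rw [Metric.mem_closedBall, dist_eq_norm]
      simp only [map_zero, mv_zero]
      have : (fs.nnnorm : ℝ) = 1 := rfl
      rw [this]
      push_cast
      linarith
    obtain ⟨z, hz, hz2⟩ := hs hmem
    exact ⟨z, by simpa using hz, hz2⟩

lemma curve {m : ℕ} (hm : m ≤ n) {F : Fin m → Hpt n → ℝ} {p : Hpt n} (hF : ∀ i, SDiff (F i) p)
    (hind : LinearIndependent ℝ (fun i => gradH (F i) p)) (hp : ∀ i, F i p = 0)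
    (v : Hz n) (hv : ∀ i, dfl (F i) p v = 0) :
    ∃ c : ℝ → Hpt n, Tendsto c (𝓝 0) (𝓝 p) ∧ (∀ᶠ s in 𝓝 0, ∀ i, F i (c s) = 0) ∧
      ∀ f, SDiff f p → (fun s => f (c s) - f p - s * dfl f p v) =o[𝓝 0] (fun s : ℝ => s) := by
  obtain ⟨L, hiso, hL⟩ := iso_exists hm (dall F p) (dall_surj hind)
  have hLc : Continuous L := LinearMap.continuous_of_finiteDimensional L
  obtain ⟨ε, hε, hest⟩ := est2 hF L hiso hL
  let q : ℝ → Hpt n := fun s => mv p (s • v)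
  have hqc : Continuous q := continuous_mv.comp
    (continuous_const.prodMk (continuous_id.smul continuous_const))
  have hq0 : Tendsto q (𝓝 0) (𝓝 p) := by
    have := hqc.tendsto 0
    simpa [q, mv_zero] using this
  have hline : ∀ f, SDiff f p → (fun s => f (q s) - f p - s * dfl f p v) =o[𝓝 0]
      (fun s : ℝ => s) := by
    intro f hf
    have hT : Tendsto (fun s : ℝ => (p, s • v)) (𝓝 0) (𝓝 (p, (0 : Hz n))) := by
      have hc : Continuous (fun s : ℝ => (p, s • v)) :=
        continuous_const.prodMk (continuous_id.smul continuous_const)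
      have := hc.tendsto 0
      simpa using this
    have h1 := hf.comp_tendsto hT
    have h2 : (fun s : ℝ => s • v) =O[𝓝 0] (fun s : ℝ => s) := by
      refine Asymptotics.IsBigO.of_bound ‖v‖ (Eventually.of_forall fun s => ?_)
      rw [norm_smul, mul_comm]
    refine (h1.trans_isBigO h2).congr_left fun s => ?_
    simp only [Function.comp, map_smul, smul_eq_mul, q]
  have hFq : (fun s => Fv F (q s)) =o[𝓝 0] (fun s : ℝ => s) := by
    rw [Asymptotics.isLittleO_pi]
    intro i
    refine (hline (F i) (hF i)).congr_left fun s => ?_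
    rw [hp, hv]; simp [Fv]
  have hsol : ∀ s, ∃ z, 2 * ‖Fv F (q s)‖ < ε → (∀ c : Fin m → ℝ, 2 * ‖c - Fv F (q s)‖ < ε →
      ∃ z, ‖z‖ ≤ 2 * ‖c - Fv F (q s)‖ ∧ Fv F (mv (q s) (L z)) = c) →
      ‖z‖ ≤ 2 * ‖Fv F (q s)‖ ∧ Fv F (mv (q s) (L z)) = 0 := by
    intro s
    by_cases h1 : 2 * ‖Fv F (q s)‖ < ε
    · by_cases h2 : (∀ c : Fin m → ℝ, 2 * ‖c - Fv F (q s)‖ < ε →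
        ∃ z, ‖z‖ ≤ 2 * ‖c - Fv F (q s)‖ ∧ Fv F (mv (q s) (L z)) = c)
      · obtain ⟨z, hz⟩ := h2 0 (by simpa using h1)
        exact ⟨z, fun _ _ => by simpa using hz⟩
      · exact ⟨0, fun _ h => absurd h h2⟩
    · exact ⟨0, fun h => absurd h h1⟩
  choose z hz using hsol
  have hsmall : ∀ᶠ s in 𝓝 (0:ℝ), 2 * ‖Fv F (q s)‖ < ε := by
    have h1 : Tendsto (fun s => Fv F (q s)) (𝓝 0) (𝓝 0) :=
      hFq.trans_tendsto tendsto_id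
    have h2 : Tendsto (fun s => 2 * ‖Fv F (q s)‖) (𝓝 0) (𝓝 0) := by
      simpa using (h1.norm.const_mul 2)
    exact h2.eventually (gt_mem_nhds hε)
  have hz' : ∀ᶠ s in 𝓝 (0:ℝ), ‖z s‖ ≤ 2 * ‖Fv F (q s)‖ ∧ Fv F (mv (q s) (L (z s))) = 0 := by
    filter_upwards [hsmall, hq0.eventually hest] with s h1 h2
    exact hz s h1 h2.2
  have hzo : z =o[𝓝 0] (fun s : ℝ => s) := by
    have : z =O[𝓝 0] (fun s => Fv F (q s)) :=
      Asymptotics.IsBigO.of_bound 2 (hz'.mono fun s h => h.1)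
    exact this.trans_isLittleO hFq
  have hz0 : Tendsto z (𝓝 0) (𝓝 0) := hzo.trans_tendsto tendsto_id
  have hT : Tendsto (fun s => (q s, L (z s))) (𝓝 0) (𝓝 (p, 0)) := by
    refine hq0.prodMk_nhds ?_
    have := (hLc.tendsto 0).comp hz0
    simpa [Function.comp_def] using this
  have hLz : (fun s => L (z s)) =o[𝓝 0] (fun s : ℝ => s) :=
    (L.toContinuousLinearMap.isBigO_comp z (𝓝 0)).trans_isLittleO hzo
  refine ⟨fun s => mv (q s) (L (z s)), ?_, ?_, ?_⟩
  · have := (continuous_mv (n := n)).tendsto (p, 0)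
    simp only [mv_zero] at this
    exact this.comp hT
  · filter_upwards [hz'] with s hs i
    exact congrFun hs.2 i
  · intro f hf
    have h1 := (hf.comp_tendsto hT).trans_isBigO (k := fun s : ℝ => s) hLz.isBigO
    have h2 : (fun s => dfl f p (L (z s))) =o[𝓝 0] (fun s : ℝ => s) :=
      ((dfl f p).toContinuousLinearMap.isBigO_comp (fun s => L (z s)) (𝓝 0)).trans_isLittleO hLz
    refine ((h1.add h2).add (hline f hf)).congr_left fun s => ?_
    simp only [Function.comp]
    ring

lemma zero_of_littleO {r : ℝ} (h : (fun s : ℝ => s * r) =o[𝓝 0] (fun s : ℝ => s)) : r = 0 := by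
  by_contra hr
  have h1 := (Asymptotics.isLittleO_iff.1 h) (c := |r| / 2) (by positivity)
  obtain ⟨δ, hδ, h2⟩ := Metric.eventually_nhds_iff.1 h1
  have h3 := h2 (y := δ / 2) (by rw [Real.dist_0_eq_abs, abs_of_pos (by positivity)]; linarith)
  rw [norm_mul, Real.norm_eq_abs, Real.norm_eq_abs, abs_of_pos (by positivity : 0 < δ / 2)] at h3
  have : 0 < |r| := abs_pos.2 hr
  nlinarith

lemma tangent {m l : ℕ} (hm : m ≤ n) {H : Fin m → Hpt n → ℝ} {F : Fin l → Hpt n → ℝ} {p : Hpt n}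
    (hH : ∀ i, SDiff (H i) p) (hF : ∀ i, SDiff (F i) p)
    (hind : LinearIndependent ℝ (fun i => gradH (H i) p)) (hp : ∀ i, H i p = 0)
    (himp : ∀ᶠ x in 𝓝 p, (∀ i, H i x = 0) → ∀ i, F i x = 0)
    (v : Hz n) (hv : ∀ i, dfl (H i) p v = 0) (i : Fin l) : dfl (F i) p v = 0 := by
  obtain ⟨c, hc, hc0, hcf⟩ := curve hm hH hind hp v hv
  have h1 := (hcf (F i) (hF i))
  have hFp : F i p = 0 := himp.self_of_nhds hp i
  have h2 : (fun s : ℝ => s * (- dfl (F i) p v)) =o[𝓝 0] (fun s : ℝ => s) := by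
    refine h1.congr' ?_ EventuallyEq.rfl
    filter_upwards [hc0, hc.eventually himp] with s hs1 hs2
    rw [hs2 hs1 i, hFp]; ring
  have := zero_of_littleO h2
  linarith

lemma germ {m : ℕ} (hm : m ≤ n) {H F : Fin m → Hpt n → ℝ} {p : Hpt n}
    (hH : ∀ i, SDiff (H i) p) (hF : ∀ i, SDiff (F i) p)
    (hHc : ∀ i, ContinuousAt (H i) p)
    (hind : LinearIndependent ℝ (fun i => gradH (H i) p))
    (hindF : LinearIndependent ℝ (fun i => gradH (F i) p)) (hp : ∀ i, H i p = 0)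
    (himp : ∀ᶠ x in 𝓝 p, (∀ i, H i x = 0) → ∀ i, F i x = 0) :
    ∀ᶠ x in 𝓝 p, (∀ i, F i x = 0) → ∀ i, H i x = 0 := by
  have hker : LinearMap.ker (dall H p) ≤ LinearMap.ker (dall F p) := by
    intro v hv
    have hv' : ∀ i, dfl (H i) p v = 0 := fun i => congrFun (LinearMap.mem_ker.1 hv) i
    rw [LinearMap.mem_ker]
    ext i
    exact tangent hm hH hF hind hp himp v hv' i
  have hfr : ∀ a : Hz n →ₗ[ℝ] (Fin m → ℝ), Function.Surjective a →
      m + Module.finrank ℝ (LinearMap.ker a) = Module.finrank ℝ (Hz n) := by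
    intro a ha
    have := LinearMap.finrank_range_add_finrank_ker a
    rw [LinearMap.range_eq_top.2 ha, finrank_top] at this
    simpa using this
  have hkeq : LinearMap.ker (dall H p) = LinearMap.ker (dall F p) := by
    refine Submodule.eq_of_le_of_finrank_eq hker ?_
    have h1 := hfr _ (dall_surj hind)
    have h2 := hfr _ (dall_surj hindF)
    omega
  obtain ⟨L, hiso, hL⟩ := iso_exists hm (dall H p) (dall_surj hind)
  have hinj : Function.Injective (dall F p ∘ₗ L) := by
    rw [← LinearMap.ker_eq_bot, LinearMap.ker_eq_bot']
    intro z hz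
    have h1 : L z ∈ LinearMap.ker (dall F p) := hz
    rw [← hkeq, LinearMap.mem_ker, hL] at h1
    exact h1
  let A := LinearEquiv.ofBijective (dall F p ∘ₗ L) ⟨hinj, LinearMap.injective_iff_surjective.1 hinj⟩
  obtain ⟨ε1, hε1, est1⟩ := est2 hH L hiso hL
  obtain ⟨ε2, hε2, est2'⟩ := est2 hF (L ∘ₗ A.symm.toLinearMap) (fun z w => hiso _ _)
    (fun z => A.apply_symm_apply z)
  have hAc : Continuous A := LinearMap.continuous_of_finiteDimensional A.toLinearMap
  have hA0 : ∀ᶠ z in 𝓝 (0 : Fin m → ℝ), ‖A z‖ < ε2 := by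
    have := (hAc.tendsto 0).norm
    simp only [map_zero, norm_zero] at this
    exact this.eventually (gt_mem_nhds hε2)
  have hev : ∀ᶠ x : Hpt n × (Fin m → ℝ) in 𝓝 (p, 0),
      ((∀ i, H i (mv x.1 (L x.2)) = 0) → ∀ i, F i (mv x.1 (L x.2)) = 0) ∧ ‖A x.2‖ < ε2 := by
    have h1 := (cont_mvL L).tendsto (p, 0)
    simp only [map_zero, mv_zero] at h1
    refine (h1.eventually himp).and ?_
    exact (continuous_snd.tendsto ((p, 0) : Hpt n × (Fin m → ℝ))).eventually hA0
  rw [nhds_prod_eq, Filter.eventually_prod_iff] at hev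
  obtain ⟨P, hP, Q, hQ, hPQ⟩ := hev
  obtain ⟨δ, hδ, hQδ⟩ := Metric.eventually_nhds_iff.1 hQ
  have hHsmall : ∀ᶠ x in 𝓝 p, 2 * ‖Fv H x‖ < min ε1 δ := by
    have h1 : Tendsto (Fv H) (𝓝 p) (𝓝 0) := by
      rw [tendsto_pi_nhds]
      intro i
      have := (hHc i).tendsto
      rw [hp i] at this
      exact this
    have h2 : Tendsto (fun s => 2 * ‖Fv H s‖) (𝓝 p) (𝓝 0) := by
      simpa using (h1.norm.const_mul 2)
    exact h2.eventually (gt_mem_nhds (lt_min hε1 hδ))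
  filter_upwards [hP, hHsmall, est1, est2'] with x hPx hxs he1 he2 hFx
  obtain ⟨z, hz, hz0⟩ := he1.2 0 (by simpa using hxs.trans_le (min_le_left _ _))
  have hzδ : dist z 0 < δ := by
    rw [dist_zero_right]
    refine lt_of_le_of_lt hz ?_
    simpa using hxs.trans_le (min_le_right _ _)
  obtain ⟨hF0, hAz⟩ := hPQ hPx (hQδ hzδ)
  have hF1 : Fv F (mv x (L z)) = 0 := funext (hF0 fun i => congrFun hz0 i)
  have h3 := he2.1 (A z) 0 hAz (by simpa using hε2)
  have e1 : (L ∘ₗ A.symm.toLinearMap) (A z) = L z := by simp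
  have e2 : Fv F x = 0 := funext hFx
  rw [e1, map_zero, mv_zero, hF1, e2, sub_zero, sub_zero, norm_zero, mul_zero] at h3
  have hAz0 : A z = 0 := norm_le_zero_iff.1 h3
  have hz00 : z = 0 := by
    have := A.injective (hAz0.trans (map_zero A).symm)
    exact this
  rw [hz00, map_zero, mv_zero] at hz0
  exact fun i => congrFun hz0 i

/-- Connectedness of the positive side. -/
lemma conn {k : ℕ} (hm : k + 1 ≤ n) {F : Fin (k+1) → Hpt n → ℝ} {p : Hpt n}
    (hF : ∀ i, SDiff (F i) p)
    (hind : LinearIndependent ℝ (fun i => gradH (F i) p)) (hp : ∀ i, F i p = 0)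
    {U : Set (Hpt n)} (hU : IsOpen U) (hpU : p ∈ U) (hc : ∀ i, ContinuousOn (F i) U) :
    ∃ B E : Set (Hpt n), IsOpen B ∧ p ∈ B ∧ B ⊆ U ∧ E ⊆ U ∧ IsPreconnected E ∧
      (∀ x ∈ E, (∀ i : Fin k, F i.castSucc x = 0) ∧ 0 < F (Fin.last k) x) ∧
      ∀ x ∈ B, (∀ i : Fin k, F i.castSucc x = 0) → 0 < F (Fin.last k) x → x ∈ E := by
  obtain ⟨L, hiso, hL⟩ := iso_exists hm (dall F p) (dall_surj hind)
  have hLc : Continuous L := LinearMap.continuous_of_finiteDimensional L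
  obtain ⟨ε, hε, hest⟩ := est2 hF L hiso hL
  have hev : ∀ᶠ x : Hpt n × (Fin (k+1) → ℝ) in 𝓝 (p, 0), mv x.1 (L x.2) ∈ U := by
    have h1 := (cont_mvL L).tendsto (p, 0)
    simp only [map_zero, mv_zero] at h1
    exact h1.eventually (hU.mem_nhds hpU)
  rw [nhds_prod_eq, Filter.eventually_prod_iff] at hev
  obtain ⟨P, hP, Q, hQ, hPQ⟩ := hev
  obtain ⟨δ, hδ, hQδ⟩ := Metric.eventually_nhds_iff.1 hQ
  set ρ := min ε δ with hρ
  have hρ0 : 0 < ρ := lt_min hε hδ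
  have hFsmall : ∀ᶠ x in 𝓝 p, ‖Fv F x‖ < ρ / 4 := by
    have h1 : Tendsto (Fv F) (𝓝 p) (𝓝 0) := by
      rw [tendsto_pi_nhds]
      intro i
      have := ((hc i).continuousAt (hU.mem_nhds hpU)).tendsto
      rw [hp i] at this
      exact this
    have h2 := h1.norm
    rw [norm_zero] at h2
    exact h2.eventually (gt_mem_nhds (by positivity))
  obtain ⟨r, hr, hball⟩ := Metric.eventually_nhds_iff_ball.1 (hest.and (hP.and hFsmall))
  let cc : ℝ → Fin (k+1) → ℝ := fun τ => Pi.single (Fin.last k) τ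
  have hcc : Continuous cc := continuous_pi fun i => by
    simp only [cc, Pi.single_apply]
    split_ifs <;> fun_prop
  have hccn : ∀ τ, ‖cc τ‖ = |τ| := fun τ => by
    refine le_antisymm ((pi_norm_le_iff_of_nonneg (abs_nonneg _)).2 fun i => ?_) ?_
    · by_cases h : i = Fin.last k
      · subst h; simp [cc]
      · simp [cc, Pi.single_eq_of_ne h]
    · have := norm_le_pi_norm (Pi.single (Fin.last k) τ : Fin (k+1) → ℝ) (Fin.last k)
      simpa using this
  have hex : ∀ x : Hpt n × ℝ, ∃ z : Fin (k+1) → ℝ,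
      x ∈ Metric.ball p r ×ˢ Ioo 0 (ρ/4) → ‖z‖ < ρ ∧ Fv F (mv x.1 (L z)) = cc x.2 := by
    intro x
    by_cases hx : x ∈ Metric.ball p r ×ˢ Ioo 0 (ρ/4)
    · obtain ⟨h1, h2, h3⟩ := hball x.1 hx.1
      have hn : 2 * ‖cc x.2 - Fv F x.1‖ < ρ := by
        have h4 := norm_sub_le (cc x.2) (Fv F x.1)
        rw [hccn, abs_of_pos hx.2.1] at h4
        have := hx.2.2
        linarith
      obtain ⟨z, hz, hz2⟩ := h1.2 (cc x.2) (hn.trans_le (min_le_left _ _))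
      exact ⟨z, fun _ => ⟨lt_of_le_of_lt hz hn, hz2⟩⟩
    · exact ⟨0, fun h => absurd h hx⟩
  choose ζ hζ using hex
  have hinU : ∀ q ∈ Metric.ball p r, ∀ z : Fin (k+1) → ℝ, ‖z‖ < ρ → mv q (L z) ∈ U := by
    intro q hq z hz
    exact hPQ (hball q hq).2.1 (hQδ (by rw [dist_zero_right]; exact hz.trans_le (min_le_right _ _)))
  have hζc : ContinuousOn ζ (Metric.ball p r ×ˢ Ioo 0 (ρ/4)) := by
    intro x0 hx0
    have hz0 := hζ x0 hx0
    rw [ContinuousWithinAt, tendsto_iff_norm_sub_tendsto_zero]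
    have hlim : Tendsto (fun x : Hpt n × ℝ => 2 * ‖cc x.2 - Fv F (mv x.1 (L (ζ x0)))‖)
        (𝓝[Metric.ball p r ×ˢ Ioo 0 (ρ/4)] x0) (𝓝 0) := by
      have hFc : ContinuousAt (Fv F) (mv x0.1 (L (ζ x0))) :=
        continuousAt_pi.2 fun i => (hc i).continuousAt (hU.mem_nhds (hinU _ hx0.1 _ hz0.1))
      have h1 : ContinuousAt (fun x : Hpt n × ℝ => mv x.1 (L (ζ x0))) x0 :=
        (continuous_mv.comp (continuous_fst.prodMk continuous_const)).continuousAt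
      have h2 : ContinuousAt (fun x : Hpt n × ℝ => Fv F (mv x.1 (L (ζ x0)))) x0 :=
        ContinuousAt.comp (g := Fv F) (f := fun x : Hpt n × ℝ => mv x.1 (L (ζ x0))) hFc h1
      have h3 : ContinuousAt (fun x : Hpt n × ℝ => cc x.2) x0 :=
        (hcc.comp continuous_snd).continuousAt
      have h4 := ((h3.sub h2).norm.tendsto.const_mul 2)
      have h5 : cc x0.2 - Fv F (mv x0.1 (L (ζ x0))) = 0 := by rw [hz0.2, sub_self]
      rw [Pi.sub_apply, h5, norm_zero, mul_zero] at h4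
      exact h4.mono_left nhdsWithin_le_nhds
    refine squeeze_zero' (Eventually.of_forall fun _ => norm_nonneg _) ?_ hlim
    filter_upwards [self_mem_nhdsWithin] with x hx
    have h1 := (hball x.1 hx.1).1.1 (ζ x) (ζ x0) ((hζ x hx).1.trans_le (min_le_left _ _))
      (hz0.1.trans_le (min_le_left _ _))
    rwa [(hζ x hx).2] at h1
  refine ⟨Metric.ball p r, (fun x : Hpt n × ℝ => mv x.1 (L (ζ x))) ''
    (Metric.ball p r ×ˢ Ioo 0 (ρ/4)), Metric.isOpen_ball, Metric.mem_ball_self hr, ?_, ?_, ?_,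
    ?_, ?_⟩
  · intro q hq
    have := hinU q hq 0 (by simpa using hρ0)
    rwa [map_zero, mv_zero] at this
  · rintro _ ⟨x, hx, rfl⟩
    exact hinU _ hx.1 _ (hζ x hx).1
  · refine IsPreconnected.image ?_ _ ?_
    · exact (convex_ball p r).isPreconnected.prod isPreconnected_Ioo
    · exact (cont_mvL L).comp_continuousOn (continuousOn_fst.prodMk hζc)
  · rintro _ ⟨x, hx, rfl⟩
    have h := (hζ x hx).2
    constructor
    · intro i
      have := congrFun h i.castSucc
      simpa [Fv, cc, Pi.single_apply, (Fin.castSucc_lt_last i).ne] using this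
    · have := congrFun h (Fin.last k)
      simp only [Fv, cc, Pi.single_eq_same] at this
      rw [this]
      exact hx.2.1
  · intro x hx h0 hpos
    have hlast : F (Fin.last k) x < ρ / 4 := by
      have h1 := norm_le_pi_norm (Fv F x) (Fin.last k)
      have h2 := (hball x hx).2.2
      have h3 : F (Fin.last k) x ≤ ‖Fv F x (Fin.last k)‖ := le_abs_self _
      linarith
    have hmem : (x, F (Fin.last k) x) ∈ Metric.ball p r ×ˢ Ioo 0 (ρ/4) := ⟨hx, hpos, hlast⟩
    refine ⟨(x, F (Fin.last k) x), hmem, ?_⟩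
    have hz := hζ _ hmem
    have hFx : Fv F x = cc (F (Fin.last k) x) := by
      ext i
      refine Fin.lastCases ?_ (fun i => ?_) i
      · simp [Fv, cc]
      · simp [Fv, cc, Pi.single_apply, (Fin.castSucc_lt_last i).ne, h0]
    have h1 := (hball x hx).1.1 (ζ (x, F (Fin.last k) x)) 0 (hz.1.trans_le (min_le_left _ _))
      (by simpa using hε)
    have h2 := hz.2
    simp only at h2 ⊢
    rw [h2, map_zero, mv_zero, hFx, sub_self, norm_zero, mul_zero, sub_zero] at h1
    rw [norm_le_zero_iff.1 h1, map_zero, mv_zero]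

/-! ## Balls of homogeneous distances are small -/

lemma hmul_hinv (p q : Hpt n) : hmul p (hmul (hinv p) q) = q := by
  simp only [hmul, hinv]
  ext i
  · simp
  · simp
  · simp only [Pi.neg_apply, Pi.add_apply, neg_mul, mul_add, add_mul, mul_neg,
      Finset.sum_add_distrib, Finset.sum_neg_distrib]
    have : ∑ j, p.1 j * p.2.1 j = ∑ j, p.1 j * p.2.1 j := rfl
    ring

lemma hinv_hmul (p : Hpt n) : hmul (hinv p) p = 0 := by
  simp only [hmul, hinv]
  ext i
  · simp
  · simp
  · simp only [Pi.neg_apply, neg_mul, mul_neg, Finset.sum_neg_distrib]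
    simp

lemma hmul_zero (p : Hpt n) : hmul p 0 = p := by
  simp [hmul]

lemma hdil_zero (l : ℝ) : hdil l (0 : Hpt n) = 0 := by
  simp [hdil]

lemma D_nonneg (D : HomDist n) (p q : Hpt n) : 0 ≤ D.d p q := by
  have h1 := D.triangle p q p
  have h2 := (D.eq_iff p p).2 rfl
  rw [D.symm q p, h2] at h1
  linarith

lemma D_pos (D : HomDist n) {q : Hpt n} (h : q ≠ 0) : 0 < D.d 0 q :=
  lt_of_le_of_ne (D_nonneg D 0 q) fun h0 => h ((D.eq_iff 0 q).1 h0.symm).symm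

lemma D_mul (D : HomDist n) (p q : Hpt n) : D.d 0 (hmul p q) ≤ D.d 0 p + D.d 0 q := by
  have h1 := D.triangle 0 p (hmul p q)
  have h2 := D.leftInv p 0 q
  rw [hmul_zero] at h2
  rwa [h2] at h1

lemma D_inv (D : HomDist n) (q : Hpt n) : D.d 0 (hinv q) = D.d 0 q := by
  have h2 := D.leftInv q 0 (hinv q)
  have h3 : hmul q (hinv q) = 0 := by
    have := hmul_hinv q 0
    rwa [hmul_zero] at this
  rw [hmul_zero, h3, D.symm] at h2
  exact h2.symm

lemma D_dil (D : HomDist n) {l : ℝ} (hl : 0 < l) (q : Hpt n) :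
    D.d 0 (hdil l q) = l * D.d 0 q := by
  have := D.homog l hl 0 q
  rwa [hdil_zero] at this

lemma hball_small (hn : 1 ≤ n) (D : HomDist n) (p : Hpt n) {V : Set (Hpt n)} (hV : V ∈ 𝓝 p) :
    ∃ r : ℝ, 0 < r ∧ hball D p r ⊆ V := by
  let i0 : Fin n := ⟨0, hn⟩
  let e : Hpt n := (Pi.single i0 1, 0, 0)
  let τ : Hpt n := (0, 0, 1)
  have he : e ≠ 0 := fun h => by
    have := congrFun (congrArg Prod.fst h) i0
    simp [e] at this
  have hτ : τ ≠ 0 := fun h => by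
    have := (congrArg (fun x : Hpt n => x.2.2) h)
    simp [τ] at this
  have hNe := D_pos D he
  have hNτ := D_pos D hτ
  have hneg : ∀ q : Hpt n, D.d 0 (q.1, q.2.1, -q.2.2) = D.d 0 q := by
    intro q
    rw [← D_inv D q]
    exact D.rotInv _ _ (by simp [hinv]) rfl
  have hneg2 : ∀ q : Hpt n, D.d 0 (-q.1, -q.2.1, q.2.2) = D.d 0 q := by
    intro q
    exact D.rotInv _ _ (by simp) rfl
  -- horizontal bound
  have hb1 : ∀ q : Hpt n, Real.sqrt (∑ j, (q.1 j ^ 2 + q.2.1 j ^ 2)) * D.d 0 e ≤ D.d 0 q := by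
    intro q
    set s := ∑ j, (q.1 j ^ 2 + q.2.1 j ^ 2) with hs
    have hs0 : 0 ≤ s := Finset.sum_nonneg fun j _ => by positivity
    rcases hs0.eq_or_lt with h0 | h0
    · rw [← h0, Real.sqrt_zero, zero_mul]; exact D_nonneg D 0 q
    have h1 := D_mul D q (q.1, q.2.1, -q.2.2)
    rw [hneg] at h1
    have h2 : hmul q (q.1, q.2.1, -q.2.2) = (q.1 + q.1, q.2.1 + q.2.1, 0) := by
      simp only [hmul]
      ext i <;> simp
    have h3 : D.d 0 (q.1 + q.1, q.2.1 + q.2.1, 0) = D.d 0 (hdil (2 * Real.sqrt s) e) := by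
      apply D.rotInv
      · have e1 : ∑ j, ((q.1 + q.1) j ^ 2 + (q.2.1 + q.2.1) j ^ 2) = 4 * s := by
          rw [hs, Finset.mul_sum]
          exact Finset.sum_congr rfl fun j _ => by simp; ring
        simp only [e1]
        have e2 : ∀ j, ((hdil (2 * Real.sqrt s) e).1 j ^ 2 + (hdil (2 * Real.sqrt s) e).2.1 j ^ 2)
            = if j = i0 then 4 * s else 0 := by
          intro j
          by_cases hj : j = i0
          · subst hj
            simp [hdil, e, mul_pow, Real.sq_sqrt hs0]; norm_num
          · simp [hdil, e, Pi.single_apply, hj]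
        simp only [e2, Finset.sum_ite_eq', Finset.mem_univ, if_true]
      · simp [hdil, e]
    rw [h2, h3, D_dil D (by positivity)] at h1
    linarith
  have hb2 : ∀ q : Hpt n, Real.sqrt (2 * |q.2.2|) * D.d 0 τ ≤ 2 * D.d 0 q := by
    intro q
    rcases (abs_nonneg q.2.2).eq_or_lt with h0 | h0
    · rw [← h0, mul_zero, Real.sqrt_zero, zero_mul]
      have := D_nonneg D 0 q
      linarith
    have h1 := D_mul D q (-q.1, -q.2.1, q.2.2)
    rw [hneg2] at h1
    have h2 : hmul q (-q.1, -q.2.1, q.2.2) = (0, 0, 2 * q.2.2) := by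
      simp only [hmul]
      ext i
      · simp
      · simp
      · simp only [Pi.neg_apply, mul_neg, neg_mul, Finset.sum_neg_distrib]; ring
    have h3 : D.d 0 (0, 0, 2 * q.2.2) = D.d 0 (hdil (Real.sqrt (2 * |q.2.2|)) τ) := by
      have e1 : (hdil (Real.sqrt (2 * |q.2.2|)) τ : Hpt n) = (0, 0, 2 * |q.2.2|) := by
        have e2 : Real.sqrt (2 * |q.2.2|) ^ 2 = 2 * |q.2.2| := Real.sq_sqrt (by positivity)
        simp only [hdil, τ, e2]
        simp
      rw [e1]
      rcases abs_cases q.2.2 with h | h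
      · rw [h.1]
      · rw [h.1, ← hneg]
        simp
    rw [h2, h3, D_dil D (by positivity)] at h1
    linarith
  have hcont : Tendsto (fun q => hmul p q) (𝓝 0) (𝓝 p) := by
    have hc : Continuous (fun q => hmul p q) := by unfold hmul; fun_prop
    have := hc.tendsto 0
    rwa [hmul_zero] at this
  obtain ⟨ε, hε, hεV⟩ := Metric.mem_nhds_iff.1 (hcont hV)
  set η := min (ε/2) 1 with hη
  have hη0 : 0 < η := lt_min (by positivity) one_pos
  refine ⟨min (η * D.d 0 e) (η * D.d 0 τ / 2), by positivity, fun x hx => ?_⟩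
  set q := hmul (hinv p) x with hq
  have hxq : x = hmul p q := (hmul_hinv p x).symm
  have hd : D.d 0 q < min (η * D.d 0 e) (η * D.d 0 τ / 2) := by
    have h1 := D.leftInv (hinv p) p x
    rw [hinv_hmul] at h1
    rw [hq, h1]
    exact hx
  have hη1 : η ≤ ε / 2 := min_le_left _ _
  have h1 : Real.sqrt (∑ j, (q.1 j ^ 2 + q.2.1 j ^ 2)) < η := by
    have := (hb1 q).trans_lt (hd.trans_le (min_le_left _ _))
    exact lt_of_mul_lt_mul_right this hNe.le
  have h2 : Real.sqrt (2 * |q.2.2|) < η := by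
    have h3 := hb2 q
    have h4 := hd.trans_le (min_le_right _ _)
    have : Real.sqrt (2 * |q.2.2|) * D.d 0 τ < η * D.d 0 τ := by linarith
    exact lt_of_mul_lt_mul_right this hNτ.le
  have hcoord : ∀ j, q.1 j ^ 2 + q.2.1 j ^ 2 ≤ ∑ j, (q.1 j ^ 2 + q.2.1 j ^ 2) := fun j =>
    Finset.single_le_sum (f := fun j => q.1 j ^ 2 + q.2.1 j ^ 2) (fun i _ => by positivity)
      (Finset.mem_univ j)
  rw [hxq]
  apply hεV
  rw [Metric.mem_ball, dist_zero_right]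
  refine lt_of_le_of_lt ?_ (show ε / 2 < ε by linarith)
  refine le_trans ?_ hη1
  rw [Prod.norm_def, Prod.norm_def]
  refine max_le ?_ (max_le ?_ ?_)
  · rw [pi_norm_le_iff_of_nonneg hη0.le]
    intro j
    rw [Real.norm_eq_abs]
    refine le_trans (Real.abs_le_sqrt ?_) h1.le
    nlinarith [hcoord j, sq_nonneg (q.2.1 j)]
  · rw [pi_norm_le_iff_of_nonneg hη0.le]
    intro j
    rw [Real.norm_eq_abs]
    refine le_trans (Real.abs_le_sqrt ?_) h1.le
    nlinarith [hcoord j, sq_nonneg (q.1 j)]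
  · rw [Real.norm_eq_abs]
    have h3 : 2 * |q.2.2| < η ^ 2 := (Real.sqrt_lt' hη0).1 h2
    have h4 : η ≤ 1 := min_le_right _ _
    nlinarith [abs_nonneg q.2.2]

/-! ## The pointwise normal -/

lemma dotH_comm (v w : Hpt n) : dotH v w = dotH w v := by
  simp only [dotH, mul_comm]

lemma dotH_comb (u v w : Hpt n) (a b : ℝ) :
    dotH u (a • v + b • w) = a * dotH u v + b * dotH u w := by
  simp only [dotH, Prod.fst_add, Prod.snd_add, Prod.smul_fst, Prod.smul_snd, Pi.add_apply,
    Pi.smul_apply, smul_eq_mul, mul_add, Finset.sum_add_distrib, Finset.mul_sum]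
  have e : ∀ (x y : Fin n → ℝ) (c : ℝ), ∑ j, x j * (c * y j) = ∑ j, c * (x j * y j) :=
    fun x y c => Finset.sum_congr rfl fun j _ => by ring
  simp only [e]
  ring

lemma dotH_self {v : Hpt n} (h : dotH v v = 0) : v = 0 := by
  have h1 : 0 ≤ ∑ j, v.1 j * v.1 j := Finset.sum_nonneg fun j _ => mul_self_nonneg _
  have h2 : 0 ≤ ∑ j, v.2.1 j * v.2.1 j := Finset.sum_nonneg fun j _ => mul_self_nonneg _
  have h3 : 0 ≤ v.2.2 * v.2.2 := mul_self_nonneg _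
  unfold dotH at h
  have h1' : ∑ j, v.1 j * v.1 j = 0 := by linarith
  have h2' : ∑ j, v.2.1 j * v.2.1 j = 0 := by linarith
  have h3' : v.2.2 * v.2.2 = 0 := by linarith
  rw [Finset.sum_eq_zero_iff_of_nonneg (fun j _ => mul_self_nonneg _)] at h1' h2'
  ext j
  · exact mul_self_eq_zero.1 (h1' j (Finset.mem_univ j))
  · exact mul_self_eq_zero.1 (h2' j (Finset.mem_univ j))
  · exact mul_self_eq_zero.1 h3'

lemma pansuD_comb (f : Hpt n → ℝ) (p v w : Hpt n) (a b : ℝ) :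
    pansuD f p (a • v + b • w) = a * pansuD f p v + b * pansuD f p w := by
  simp only [pansuD_eq]
  have : (((a • v + b • w).1, (a • v + b • w).2.1) : Hz n)
      = a • ((v.1, v.2.1) : Hz n) + b • ((w.1, w.2.1) : Hz n) := rfl
  rw [this, map_add, map_smul, map_smul]
  rfl

/-- `ν` is the unit outward normal at `p` relative to the frame `f`. -/
def NormalAt {k : ℕ} (f : Fin (k+1) → Hpt n → ℝ) (p ν : Hpt n) : Prop :=
  dotH ν ν = 1 ∧ (∀ i : Fin k, pansuD (f i.castSucc) p ν = 0) ∧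
    (∀ w : Hpt n, (∀ i : Fin (k+1), pansuD (f i) p w = 0) → dotH ν w = 0) ∧
    pansuD (f (Fin.last k)) p ν < 0

lemma normal_unique {k : ℕ} {f : Fin (k+1) → Hpt n → ℝ} {p ν ν' : Hpt n}
    (h : NormalAt f p ν) (h' : NormalAt f p ν') : ν = ν' := by
  obtain ⟨h1, h2, h3, h4⟩ := h
  obtain ⟨h1', h2', h3', h4'⟩ := h'
  set α := pansuD (f (Fin.last k)) p ν with hα
  set α' := pansuD (f (Fin.last k)) p ν' with hα'
  have hw : ∀ i : Fin (k+1), pansuD (f i) p (α' • ν + (-α) • ν') = 0 := by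
    intro i
    rw [pansuD_comb]
    refine Fin.lastCases ?_ (fun i => ?_) i
    · rw [← hα, ← hα']; ring
    · rw [h2 i, h2' i]; ring
  have e1 := h3 _ hw
  have e2 := h3' _ hw
  rw [dotH_comb, h1] at e1
  rw [dotH_comb, h1', dotH_comm ν' ν] at e2
  set c := dotH ν ν' with hc
  have e3 : (1 - c) * (α + α') = 0 := by linarith
  have e4 : 1 - c = 0 := by
    rcases mul_eq_zero.1 e3 with h | h
    · exact h
    · linarith
  have e5 : dotH ((1:ℝ) • ν + (-1:ℝ) • ν') ((1:ℝ) • ν + (-1:ℝ) • ν') = 0 := by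
    rw [dotH_comb, dotH_comm _ ν, dotH_comm _ ν', dotH_comb, dotH_comb, h1, h1', dotH_comm ν' ν,
      ← hc]
    linarith
  have e6 := dotH_self e5
  have e7 : ν - ν' = 0 := by
    rw [← e6]; simp [sub_eq_add_neg]
  exact sub_eq_zero.1 e7

/-- Unnormalized outward normal. -/
def unv {k : ℕ} (F : Fin (k+1) → Hpt n → ℝ) (q : Hpt n) : Hz n :=
  ∑ j, (-(gram F q).det * (gram F q).adjugate j (Fin.last k)) • gz (F j) q

lemma dfl_unv {k : ℕ} (F : Fin (k+1) → Hpt n → ℝ) (q : Hpt n) (i : Fin (k+1)) :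
    dfl (F i) q (unv F q) = if i = Fin.last k then -(gram F q).det ^ 2 else 0 := by
  unfold unv
  rw [← gram_mulVec F q (fun j => -(gram F q).det * (gram F q).adjugate j (Fin.last k))]
  have h1 : (gram F q * (gram F q).adjugate) i (Fin.last k)
      = ((gram F q).det • (1 : Matrix (Fin (k+1)) (Fin (k+1)) ℝ)) i (Fin.last k) := by
    rw [Matrix.mul_adjugate]
  rw [Matrix.mul_apply, Matrix.smul_apply, Matrix.one_apply] at h1
  have h2 : (gram F q).mulVec (fun j => -(gram F q).det * (gram F q).adjugate j (Fin.last k)) i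
      = -(gram F q).det * ∑ j, gram F q i j * (gram F q).adjugate j (Fin.last k) := by
    rw [Matrix.mulVec, dotProduct, Finset.mul_sum]
    exact Finset.sum_congr rfl fun j _ => by ring
  rw [h2, h1]
  split_ifs
  · simp; ring
  · simp

lemma hdot_comm (v w : Hz n) : hdot v w = hdot w v := by
  simp only [hdot, mul_comm]

lemma hdot_nonneg (v : Hz n) : 0 ≤ hdot v v :=
  Finset.sum_nonneg fun _ _ => add_nonneg (mul_self_nonneg _) (mul_self_nonneg _)

/-- Normalized outward normal. -/
def nv {k : ℕ} (F : Fin (k+1) → Hpt n → ℝ) (q : Hpt n) : Hpt n :=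
  (Real.sqrt (hdot (unv F q) (unv F q)))⁻¹ • ex (unv F q)

lemma unv_pos {k : ℕ} {F : Fin (k+1) → Hpt n → ℝ} {q : Hpt n}
    (hind : LinearIndependent ℝ (fun i => gradH (F i) q)) : 0 < hdot (unv F q) (unv F q) := by
  refine lt_of_le_of_ne (hdot_nonneg _) fun h => ?_
  have h1 := hdot_self h.symm
  have h2 := dfl_unv F q (Fin.last k)
  rw [h1, map_zero, if_pos rfl] at h2
  have := pow_ne_zero 2 (gram_det hind)
  apply this
  linarith

lemma dotH_smul_ex (s : ℝ) (u : Hz n) (w : Hpt n) :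
    dotH (s • ex u) w = s * hdot u (w.1, w.2.1) := by
  simp only [dotH, ex, hdot, Prod.smul_fst, Prod.smul_snd, Pi.smul_apply, smul_eq_mul, mul_zero,
    zero_mul, add_zero, Finset.mul_sum]
  rw [← Finset.sum_add_distrib]
  exact Finset.sum_congr rfl fun j _ => by ring

lemma pansuD_smul_ex (f : Hpt n → ℝ) (p : Hpt n) (s : ℝ) (u : Hz n) :
    pansuD f p (s • ex u) = s * dfl f p u := by
  rw [pansuD_eq]
  have : (((s • ex u).1, (s • ex u).2.1) : Hz n) = s • u := rfl
  rw [this, map_smul]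
  rfl

lemma normal_nv {k : ℕ} {F : Fin (k+1) → Hpt n → ℝ} {q : Hpt n}
    (hind : LinearIndependent ℝ (fun i => gradH (F i) q)) : NormalAt F q (nv F q) := by
  have hpos := unv_pos hind
  have hs := Real.sqrt_pos.2 hpos
  refine ⟨?_, fun i => ?_, fun w hw => ?_, ?_⟩
  · unfold nv
    rw [dotH_smul_ex]
    have : ∀ s : ℝ, hdot (unv F q) ((s • ex (unv F q)).1, (s • ex (unv F q)).2.1)
        = s * hdot (unv F q) (unv F q) := by
      intro s
      simp only [hdot, ex, Prod.smul_fst, Prod.smul_snd, Pi.smul_apply, smul_eq_mul,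
        Finset.mul_sum]
      exact Finset.sum_congr rfl fun j _ => by ring
    rw [this]
    nth_rewrite 3 [← Real.mul_self_sqrt hpos.le]
    field_simp
  · unfold nv
    rw [pansuD_smul_ex, dfl_unv, if_neg (Fin.castSucc_lt_last i).ne, mul_zero]
  · unfold nv
    rw [dotH_smul_ex, hdot_comm (unv F q) (w.1, w.2.1)]
    have : hdot ((w.1, w.2.1) : Hz n) (unv F q) = 0 := by
      unfold unv
      rw [hdot_comb]
      exact Finset.sum_eq_zero fun j _ => by rw [← pansuD_eq, hw j, mul_zero]
    rw [this, mul_zero]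
  · unfold nv
    rw [pansuD_smul_ex, dfl_unv, if_pos rfl]
    have h1 : 0 < (gram F q).det ^ 2 := by
      have := gram_det hind
      positivity
    have h2 := inv_pos.2 hs
    nlinarith

lemma gz_cont {U : Set (Hpt n)} {f : Hpt n → ℝ} (hf : IsC1H U f) : ContinuousOn (gz f) U := by
  unfold gz
  exact (continuousOn_pi.2 fun j => hf.contGrad _).prodMk (continuousOn_pi.2 fun j => hf.contGrad _)

lemma hdot_cont {U : Set (Hpt n)} {a b : Hpt n → Hz n} (ha : ContinuousOn a U)
    (hb : ContinuousOn b U) : ContinuousOn (fun q => hdot (a q) (b q)) U := by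
  have : Continuous (fun x : Hz n × Hz n => hdot x.1 x.2) := by
    unfold hdot; fun_prop
  exact this.comp_continuousOn (ha.prodMk hb)

lemma nv_cont {k : ℕ} {F : Fin (k+1) → Hpt n → ℝ} {U : Set (Hpt n)}
    (hF : ∀ i, IsC1H U (F i))
    (hind : ∀ q ∈ U, LinearIndependent ℝ (fun i => gradH (F i) q)) : ContinuousOn (nv F) U := by
  have hg : ContinuousOn (gram F) U := by
    refine continuousOn_pi.2 fun i => continuousOn_pi.2 fun j => ?_
    exact hdot_cont (gz_cont (hF j)) (gz_cont (hF i))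
  have hdet : ContinuousOn (fun q => (gram F q).det) U :=
    (Continuous.matrix_det continuous_id).comp_continuousOn hg
  have hadj : ContinuousOn (fun q => (gram F q).adjugate) U :=
    (Continuous.matrix_adjugate continuous_id).comp_continuousOn hg
  have hu : ContinuousOn (unv F) U := by
    unfold unv
    refine continuousOn_finsetSum _ fun j _ => ?_
    refine (hdet.neg.mul ?_).smul (gz_cont (hF j))
    exact (continuous_apply_apply j (Fin.last k)).comp_continuousOn hadj
  have hs : ContinuousOn (fun q => Real.sqrt (hdot (unv F q) (unv F q))) U :=
    Real.continuous_sqrt.comp_continuousOn (hdot_cont hu hu)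
  have hs' : ContinuousOn (fun q => (Real.sqrt (hdot (unv F q) (unv F q)))⁻¹) U :=
    hs.inv₀ fun q hq => (Real.sqrt_pos.2 (unv_pos (hind q hq))).ne'
  have he : Continuous (ex (n := n)) := by unfold ex; fun_prop
  exact hs'.smul (he.comp_continuousOn hu)

/-! ## Independence of the frame -/

lemma div_tend {g : ℝ → ℝ} {β : ℝ}
    (h : (fun s => g s - s * β) =o[𝓝 0] (fun s : ℝ => s)) :
    Tendsto (fun s => g s / s) (𝓝[>] 0) (𝓝 β) := by
  have h1 := (h.tendsto_div_nhds_zero.mono_left (nhdsWithin_le_nhds (s := Ioi 0))).add_const β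
  rw [zero_add] at h1
  refine h1.congr' ?_
  filter_upwards [self_mem_nhdsWithin] with s hs
  have : s ≠ 0 := ne_of_gt hs
  field_simp
  ring

lemma frame_zero {k : ℕ} {S U : Set (Hpt n)} {p q : Hpt n} {f : Fin (k+1) → Hpt n → ℝ}
    (hf : IsBdryFrame k S p U f) (hq : q ∈ U) (hqS : q ∈ bdry S) : ∀ i, f i q = 0 := by
  obtain ⟨hU, hpU, hC, hind, hS, h0⟩ := hf
  have hfr : ∃ᶠ x in 𝓝 q, x ∈ U ∩ S := by
    have := mem_closure_iff_frequently.1 hqS.1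
    exact (this.and_eventually (hU.mem_nhds hq)).mono fun x hx => ⟨hx.2, hx.1⟩
  rw [hS] at hfr
  have hc : ∀ i, Tendsto (f i) (𝓝 q) (𝓝 (f i q)) := fun i =>
    ((hC i).contOn.continuousAt (hU.mem_nhds hq)).tendsto
  have hz : ∀ i : Fin k, f i.castSucc q = 0 := by
    intro i
    by_contra hne
    have := (hc i.castSucc).eventually (isOpen_ne.mem_nhds hne)
    obtain ⟨x, hx1, hx2⟩ := (hfr.and_eventually this).exists
    exact hx2 (hx1.2.1 i)
  have hl : 0 ≤ f (Fin.last k) q := by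
    by_contra hne
    have := (hc (Fin.last k)).eventually (isOpen_Iio.mem_nhds (not_le.1 hne))
    obtain ⟨x, hx1, hx2⟩ := (hfr.and_eventually this).exists
    exact absurd hx1.2.2 (not_lt.2 (le_of_lt hx2))
  intro i
  refine Fin.lastCases ?_ (fun i => hz i) i
  by_contra hne
  have hmem : q ∈ U ∩ S := by
    rw [hS]
    exact ⟨hq, hz, lt_of_le_of_ne hl (Ne.symm hne)⟩
  exact hqS.2 hmem.2

lemma frame_move {k : ℕ} {S U : Set (Hpt n)} {p q : Hpt n} {f : Fin (k+1) → Hpt n → ℝ}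
    (hf : IsBdryFrame k S p U f) (hq : q ∈ U) (hqS : q ∈ bdry S) : IsBdryFrame k S q U f :=
  ⟨hf.1, hq, hf.2.2.1, hf.2.2.2.1, hf.2.2.2.2.1, frame_zero hf hq hqS _⟩

lemma half_space {k : ℕ} (hk : k ≤ n) {S U U' : Set (Hpt n)} {p : Hpt n}
    {f f' : Fin (k+1) → Hpt n → ℝ}
    (hf : IsBdryFrame k S p U f) (hf' : IsBdryFrame k S p U' f') (hp : p ∈ bdry S)
    (v : Hz n) (hv : ∀ i : Fin k, dfl (f i.castSucc) p v = 0)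
    (hv1 : 0 < dfl (f (Fin.last k)) p v) :
    (∀ i : Fin k, dfl (f' i.castSucc) p v = 0) ∧ 0 ≤ dfl (f' (Fin.last k)) p v := by
  have hz := frame_zero hf hf.2.1 hp
  have hz' := frame_zero hf' hf'.2.1 hp
  have hsd : ∀ i, SDiff (f i) p := fun i => IsC1H.sdiff hf.1 (hf.2.2.1 i) hf.2.1
  have hsd' : ∀ i, SDiff (f' i) p := fun i => IsC1H.sdiff hf'.1 (hf'.2.2.1 i) hf'.2.1
  obtain ⟨c, hc, hc0, hcf⟩ := curve hk (F := fun i : Fin k => f i.castSucc) (p := p)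
    (fun i => hsd _)
    ((hf.2.2.2.1 p hf.2.1).comp Fin.castSucc (Fin.castSucc_injective k)) (fun i => hz _) v hv
  have hlim : ∀ i, Tendsto (fun s => f i (c s) / s) (𝓝[>] 0) (𝓝 (dfl (f i) p v)) := fun i =>
    div_tend (by simpa only [hz i, sub_zero] using hcf _ (hsd i))
  have hlim' : ∀ i, Tendsto (fun s => f' i (c s) / s) (𝓝[>] 0) (𝓝 (dfl (f' i) p v)) := fun i =>
    div_tend (by simpa only [hz' i, sub_zero] using hcf _ (hsd' i))
  have hin : ∀ᶠ s in 𝓝[>] (0:ℝ), 0 < s ∧ c s ∈ U' ∩ S := by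
    filter_upwards [self_mem_nhdsWithin, nhdsWithin_le_nhds hc0,
      nhdsWithin_le_nhds (hc.eventually (hf.1.mem_nhds hf.2.1)),
      nhdsWithin_le_nhds (hc.eventually (hf'.1.mem_nhds hf'.2.1)),
      (hlim (Fin.last k)).eventually (isOpen_Ioi.mem_nhds hv1)] with s h1 h2 h3 h4 h5
    have h6 : c s ∈ U ∩ S := by
      rw [hf.2.2.2.2.1]
      refine ⟨h3, h2, ?_⟩
      have h7 : 0 < f (Fin.last k) (c s) / s := h5
      have h8 : (0:ℝ) < s := h1
      have h9 := mul_pos h7 h8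
      rwa [div_mul_cancel₀ _ h8.ne'] at h9
    exact ⟨h1, h4, h6.2⟩
  rw [hf'.2.2.2.2.1] at hin
  constructor
  · intro i
    refine tendsto_nhds_unique (hlim' i.castSucc) (tendsto_const_nhds.congr' ?_)
    filter_upwards [hin] with s hs
    rw [hs.2.2.1 i, zero_div]
  · refine ge_of_tendsto (hlim' (Fin.last k)) ?_
    filter_upwards [hin] with s hs
    exact (div_pos hs.2.2.2 hs.1).le

lemma normal_indep {k : ℕ} (hk : k ≤ n) {S U U' : Set (Hpt n)} {p ν : Hpt n}
    {f f' : Fin (k+1) → Hpt n → ℝ}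
    (hf : IsBdryFrame k S p U f) (hf' : IsBdryFrame k S p U' f') (hp : p ∈ bdry S)
    (hν : NormalAt f p ν) : NormalAt f' p ν := by
  obtain ⟨h1, h2, h3, h4⟩ := hν
  have hneg := half_space hk hf hf' hp (-((ν.1, ν.2.1) : Hz n))
    (fun i => by rw [map_neg, ← pansuD_eq, h2 i, neg_zero])
    (by rw [map_neg, ← pansuD_eq]; linarith)
  have g2 : ∀ i : Fin k, pansuD (f' i.castSucc) p ν = 0 := by
    intro i
    have := hneg.1 i
    rw [map_neg, ← pansuD_eq] at this
    linarith
  have g3 : ∀ w : Hpt n, (∀ i : Fin (k+1), pansuD (f' i) p w = 0) → dotH ν w = 0 := by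
    intro w hw
    refine h3 w ?_
    have hdet : 0 < (gram f' p).det ^ 2 := by
      have := gram_det (hf'.2.2.2.1 p hf'.2.1)
      positivity
    have key : ∀ s : ℝ, (∀ i : Fin k, dfl (f i.castSucc) p
        (-(unv f' p) + s • ((w.1, w.2.1) : Hz n)) = 0) ∧
        0 ≤ dfl (f (Fin.last k)) p (-(unv f' p) + s • ((w.1, w.2.1) : Hz n)) := by
      intro s
      refine half_space hk hf' hf hp _ (fun i => ?_) ?_
      · rw [map_add, map_neg, map_smul, ← pansuD_eq, hw, dfl_unv,
          if_neg (Fin.castSucc_lt_last i).ne]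
        simp
      · rw [map_add, map_neg, map_smul, ← pansuD_eq, hw, dfl_unv, if_pos rfl]
        simpa using hdet
    intro i
    refine Fin.lastCases ?_ (fun i => ?_) i
    · by_contra hne
      set a := dfl (f (Fin.last k)) p (-(unv f' p)) with ha
      have := (key (-(a + 1) / pansuD (f (Fin.last k)) p w)).2
      rw [map_add, map_smul, ← pansuD_eq, ← ha, smul_eq_mul, div_mul_cancel₀ _ hne] at this
      linarith
    · have e1 := (key 1).1 i
      have e0 := (key 0).1 i
      rw [map_add, map_smul, ← pansuD_eq, smul_eq_mul] at e0 e1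
      linarith
  refine ⟨h1, g2, g3, ?_⟩
  have hle : pansuD (f' (Fin.last k)) p ν ≤ 0 := by
    have := hneg.2
    rw [map_neg, ← pansuD_eq] at this
    linarith
  refine lt_of_le_of_ne hle fun h0 => ?_
  have := g3 ν fun i => Fin.lastCases h0 (fun i => g2 i) i
  rw [h1] at this
  exact one_ne_zero this

/-- The main theorem, given existence of frames. -/
lemma main_of_frames {k : ℕ} (hk : k ≤ n) {O S : Set (Hpt n)}
    (hfr : ∀ p ∈ O ∩ bdry S, ∃ (U : Set (Hpt n)) (f : Fin (k+1) → Hpt n → ℝ),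
      IsBdryFrame k S p U f) :
    ∃ ν : Hpt n → Hpt n, IsUnitOutwardNormal k O S ν ∧
      ∀ ν' : Hpt n → Hpt n, IsUnitOutwardNormal k O S ν' → Set.EqOn ν' ν (O ∩ bdry S) := by
  classical
  have hex : ∀ p : Hpt n, ∃ (U : Set (Hpt n)) (f : Fin (k+1) → Hpt n → ℝ),
      p ∈ O ∩ bdry S → IsBdryFrame k S p U f := by
    intro p
    by_cases hp : p ∈ O ∩ bdry S
    · obtain ⟨U, f, h⟩ := hfr p hp
      exact ⟨U, f, fun _ => h⟩
    · exact ⟨∅, 0, fun h => absurd h hp⟩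
  choose U f hf using hex
  let ν : Hpt n → Hpt n := fun p => nv (f p) p
  have hN : ∀ p ∈ O ∩ bdry S, NormalAt (f p) p (ν p) := fun p hp =>
    normal_nv ((hf p hp).2.2.2.1 p (hf p hp).2.1)
  have hcont : ContinuousOn ν (O ∩ bdry S) := by
    intro p hp
    have hF := hf p hp
    have h1 : ContinuousWithinAt (nv (f p)) (O ∩ bdry S) p :=
      ((nv_cont hF.2.2.1 hF.2.2.2.1).continuousAt (hF.1.mem_nhds hF.2.1)).continuousWithinAt
    refine h1.congr_of_eventuallyEq ?_ rfl
    filter_upwards [self_mem_nhdsWithin, nhdsWithin_le_nhds (hF.1.mem_nhds hF.2.1)] with q hq hqU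
    have h2 := frame_move hF hqU hq.2
    exact normal_unique (hN q hq) (normal_indep hk h2 (hf q hq) hq.2 (normal_nv (hF.2.2.2.1 q hqU)))
  refine ⟨ν, ⟨hcont, fun p hp => ⟨(hN p hp).1, fun V g hg => ?_⟩⟩, fun ν' hν' p hp => ?_⟩
  · exact (normal_indep hk (hf p hp) hg hp.2 (hN p hp)).2
  · have h1 := hν'.2 p hp
    exact normal_unique ⟨h1.1, h1.2 _ _ (hf p hp)⟩ (hN p hp)

/-! ## Existence of frames -/

lemma gradH_neg (f : Hpt n → ℝ) (p : Hpt n) : gradH (fun x => -f x) p = -gradH f p := by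
  ext j
  simp only [gradH, lineDeriv, Pi.neg_apply]
  exact deriv.fun_neg

lemma isC1H_neg {U : Set (Hpt n)} {f : Hpt n → ℝ} (hf : IsC1H U f) :
    IsC1H U (fun x => -f x) where
  contOn := hf.contOn.neg
  ldiff := fun p hp j => by
    have := hf.ldiff p hp j
    unfold LineDifferentiableAt at this ⊢
    exact this.neg
  contGrad := fun j => by
    simp only [gradH_neg, Pi.neg_apply]
    exact (hf.contGrad j).neg

lemma isC1H_mono {U V : Set (Hpt n)} {f : Hpt n → ℝ} (hf : IsC1H U f) (h : V ⊆ U) : IsC1H V f where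
  contOn := hf.contOn.mono h
  ldiff := fun p hp j => hf.ldiff p (h hp) j
  contGrad := fun j => (hf.contGrad j).mono h

/-- Append a function to a family. -/
def app {k : ℕ} (f : Fin k → Hpt n → ℝ) (g : Hpt n → ℝ) : Fin (k+1) → Hpt n → ℝ :=
  Fin.snoc (α := fun _ => Hpt n → ℝ) f g

lemma app_castSucc {k : ℕ} (f : Fin k → Hpt n → ℝ) (g : Hpt n → ℝ) (i : Fin k) :
    app f g i.castSucc = f i := by simp [app]

lemma app_last {k : ℕ} (f : Fin k → Hpt n → ℝ) (g : Hpt n → ℝ) :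
    app f g (Fin.last k) = g := by simp [app]

lemma app_all {k : ℕ} {f : Fin k → Hpt n → ℝ} {g : Hpt n → ℝ} {P : (Hpt n → ℝ) → Prop}
    (h1 : ∀ i, P (f i)) (h2 : P g) (i : Fin (k+1)) : P (app f g i) := by
  refine Fin.lastCases ?_ (fun i => ?_) i
  · rwa [app_last]
  · rw [app_castSucc]; exact h1 i

lemma app_indep {k : ℕ} {f : Fin k → Hpt n → ℝ} {g : Hpt n → ℝ} {p : Hpt n}
    (h : LinearIndependent ℝ (fun i => gradH (f i) p))
    (hg : gradH g p ∉ Submodule.span ℝ (range fun i => gradH (f i) p)) :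
    LinearIndependent ℝ (fun i => gradH (app f g i) p) := by
  have e : (fun i => gradH (app f g i) p)
      = Fin.snoc (α := fun _ => Fin (2*n) → ℝ) (fun i => gradH (f i) p) (gradH g p) := by
    funext i
    refine Fin.lastCases ?_ (fun i => ?_) i
    · rw [app_last, Fin.snoc_last]
    · rw [app_castSucc, Fin.snoc_castSucc]
  rw [e]
  exact linearIndependent_finSnoc.2 ⟨h, hg⟩

lemma indep_near {m : ℕ} {F : Fin m → Hpt n → ℝ} {p : Hpt n} {U : Set (Hpt n)} (hU : IsOpen U)
    (hp : p ∈ U) (hF : ∀ i, IsC1H U (F i))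
    (h : LinearIndependent ℝ (fun i => gradH (F i) p)) :
    ∀ᶠ x in 𝓝 p, LinearIndependent ℝ (fun i => gradH (F i) x) := by
  have hc : ContinuousAt (fun x => fun i => gradH (F i) x) p :=
    continuousAt_pi.2 fun i => continuousAt_pi.2 fun j =>
      ((hF i).contGrad j).continuousAt (hU.mem_nhds hp)
  exact hc.eventually (isOpen_setOfPred_linearIndependent.mem_nhds h)

lemma side {k : ℕ} (hm : k + 1 ≤ n) {f : Fin k → Hpt n → ℝ} {g : Hpt n → ℝ} {p : Hpt n}
    {U S : Set (Hpt n)} (hU : IsOpen U) (hpU : p ∈ U)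
    (hf : ∀ i, IsC1H U (f i)) (hg : IsC1H U g)
    (hind : LinearIndependent ℝ (fun i => gradH (app f g i) p))
    (hfp : ∀ i, f i p = 0) (hgp : g p = 0)
    (hloc : ∀ q ∈ U, q ∈ S → ∀ᶠ x in 𝓝 q, (∀ i, f i x = 0) → x ∈ S)
    (hb : ∀ x ∈ U, 0 < g x → x ∉ bdry S) :
    ∃ B : Set (Hpt n), IsOpen B ∧ p ∈ B ∧ B ⊆ U ∧
      ((∀ x ∈ B, (∀ i, f i x = 0) → 0 < g x → x ∈ S) ∨
       (∀ x ∈ B, (∀ i, f i x = 0) → 0 < g x → x ∉ S)) := by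
  have hF : ∀ i, IsC1H U (app f g i) := fun i => app_all (P := IsC1H U) hf hg i
  obtain ⟨B, E, hB, hpB, hBU, hEU, hE, hE1, hE2⟩ := conn hm (F := app f g)
    (fun i => IsC1H.sdiff hU (hF i) hpU) hind
    (fun i => app_all (P := fun h => h p = 0) hfp hgp i) hU hpU (fun i => (hF i).contOn)
  simp only [app_castSucc, app_last] at hE1 hE2
  refine ⟨B, hB, hpB, hBU, ?_⟩
  by_cases hne : (E ∩ S).Nonempty
  · left
    intro x hxB hfx hgx
    have hxE := hE2 x hxB hfx hgx
    by_contra hxS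
    have hcl : ∀ y ∈ E, y ∉ S → y ∈ (closure S)ᶜ := fun y hy hyS hyc =>
      hb y (hEU hy) (hE1 y hy).2 ⟨hyc, hyS⟩
    have hinu : ∀ y ∈ E, y ∈ S → y ∈ {q | ∀ᶠ x in 𝓝 q, (∀ i, f i x = 0) → x ∈ S} :=
      fun y hy hyS => hloc y (hEU hy) hyS
    obtain ⟨y, hyE, hyu, hyv⟩ := hE {q | ∀ᶠ x in 𝓝 q, (∀ i, f i x = 0) → x ∈ S} (closure S)ᶜ
      isOpen_setOfPred_eventually_nhds isClosed_closure.isOpen_compl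
      (fun y hy => by
        by_cases hyS : y ∈ S
        · exact Or.inl (hinu y hy hyS)
        · exact Or.inr (hcl y hy hyS))
      (by
        obtain ⟨y, hyE, hyS⟩ := hne
        exact ⟨y, hyE, hinu y hyE hyS⟩)
      ⟨x, hxE, hcl x hxE hxS⟩
    have hyu' : ∀ᶠ x in 𝓝 y, (∀ i, f i x = 0) → x ∈ S := hyu
    exact hyv (subset_closure (hyu'.self_of_nhds (hE1 y hyE).1))
  · right
    intro x hxB hfx hgx hxS
    exact hne ⟨x, hE2 x hxB hfx hgx, hxS⟩

lemma frame_exists (hn : 1 ≤ n) (D : HomDist n) {k : ℕ} (hm : k + 1 ≤ n) {O S : Set (Hpt n)}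
    (hO : IsOpen O) (hS : IsC1HSubWithBdry D k O S) (p : Hpt n) (hp : p ∈ O ∩ bdry S) :
    ∃ (U : Set (Hpt n)) (f : Fin (k+1) → Hpt n → ℝ), IsBdryFrame k S p U f := by
  have hk : k ≤ n := by omega
  obtain ⟨-, hSsub, -, hbsub, hext⟩ := hS
  rw [IsC1HSub, if_pos hk] at hSsub
  rw [IsC1HSub, if_pos hm] at hbsub
  obtain ⟨U1, hU1, hpU1, S', hS'U, hS'sub, hcl, hball⟩ := hext p hp
  rw [IsC1HSub, if_pos hk] at hS'sub
  have hpS' : p ∈ S' := hcl ⟨hpU1, hp.2.1⟩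
  obtain ⟨U2, hU2, hpU2, f, hf, hfind, hfS⟩ := hS'sub p hpS'
  obtain ⟨U3, hU3, hpU3, G, hG, hGind, hGS⟩ := hbsub p hp
  have hclf : ∀ x ∈ U1, x ∈ U2 → x ∈ closure S → ∀ i, f i x = 0 := by
    intro x h1 h2 h3
    have : x ∈ S' ∩ U2 := ⟨hcl ⟨h1, h3⟩, h2⟩
    rw [hfS] at this
    exact this.2
  have hGb : ∀ x ∈ U3, (∀ i, G i x = 0) → x ∈ O ∩ bdry S := by
    intro x h1 h2
    have : x ∈ (O ∩ bdry S) ∩ U3 := by rw [hGS]; exact ⟨h1, h2⟩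
    exact this.1
  have hbG : ∀ x ∈ U3, x ∈ O → x ∈ bdry S → ∀ i, G i x = 0 := by
    intro x h1 h2 h3
    have : x ∈ (O ∩ bdry S) ∩ U3 := ⟨⟨h2, h3⟩, h1⟩
    rw [hGS] at this
    exact this.2
  have hfp := hclf p hpU1 hpU2 hp.2.1
  have hGp := hbG p hpU3 hp.1 hp.2
  have hfi := hfind p hpU2
  -- choose an independent boundary function
  obtain ⟨j, hj⟩ : ∃ j, gradH (G j) p ∉ Submodule.span ℝ (range fun i => gradH (f i) p) := by
    by_contra hcon
    push Not at hcon
    have h1 : Submodule.span ℝ (range fun i => gradH (G i) p)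
        ≤ Submodule.span ℝ (range fun i => gradH (f i) p) := by
      rw [Submodule.span_le]
      rintro _ ⟨i, rfl⟩
      exact hcon i
    have h2 := Submodule.finrank_mono h1
    rw [finrank_span_eq_card (hGind p hpU3), finrank_span_eq_card hfi] at h2
    simp at h2
  have hj' : gradH (fun x => -G j x) p ∉ Submodule.span ℝ (range fun i => gradH (f i) p) := by
    rw [gradH_neg, Submodule.neg_mem_iff]
    exact hj
  have hi1 := app_indep hfi hj
  have hi2 := app_indep hfi hj'
  set W := U1 ∩ U2 ∩ U3 ∩ O with hW
  have hWo : IsOpen W := ((hU1.inter hU2).inter hU3).inter hO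
  have hpW : p ∈ W := ⟨⟨⟨hpU1, hpU2⟩, hpU3⟩, hp.1⟩
  have hfW : ∀ i, IsC1H W (f i) := fun i => isC1H_mono (hf i) fun x hx => hx.1.1.2
  have hgW : IsC1H W (G j) := isC1H_mono (hG j) fun x hx => hx.1.2
  have hgW' : IsC1H W (fun x => -G j x) := isC1H_neg hgW
  have hF1 : ∀ i, IsC1H W (app f (G j) i) := fun i => app_all (P := IsC1H W) hfW hgW i
  have hF2 : ∀ i, IsC1H W (app f (fun x => -G j x) i) := fun i =>
    app_all (P := IsC1H W) hfW hgW' i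
  have hgerm : ∀ᶠ x in 𝓝 p, (∀ i, app f (G j) i x = 0) → ∀ i, G i x = 0 := by
    refine germ hm (fun i => IsC1H.sdiff hU3 (hG i) hpU3)
      (fun i => IsC1H.sdiff hWo (hF1 i) hpW)
      (fun i => (hG i).contOn.continuousAt (hU3.mem_nhds hpU3)) (hGind p hpU3) hi1 hGp ?_
    filter_upwards [hWo.mem_nhds hpW] with x hx hGx i
    exact app_all (P := fun h => h x = 0)
      (hclf x hx.1.1.1 hx.1.1.2 (hGb x hx.1.2 hGx).2.1) (hGx j) i
  have hWev : ∀ᶠ x in 𝓝 p, x ∈ W := hWo.mem_nhds hpW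
  obtain ⟨U4, hU4s, hU4, hpU4⟩ := eventually_nhds_iff.1
    (hWev.and (hgerm.and
      ((indep_near hWo hpW hF1 hi1).and (indep_near hWo hpW hF2 hi2))))
  have h4W : U4 ⊆ W := fun x hx => (hU4s _ hx).1
  have h4g : ∀ x ∈ U4, (∀ i, f i x = 0) → G j x = 0 → x ∈ bdry S := fun x hx h1 h2 =>
    (hGb x (h4W hx).1.2 ((hU4s _ hx).2.1 fun i =>
      app_all (P := fun h => h x = 0) h1 h2 i)).2
  have hloc : ∀ q ∈ U4, q ∈ S → ∀ᶠ x in 𝓝 q, (∀ i, f i x = 0) → x ∈ S := by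
    intro q hq hqS
    have hqW := h4W hq
    obtain ⟨U5, hU5, hqU5, h, hh, hhind, hhS⟩ := hSsub q ⟨hqW.2, hqS⟩
    have hqh : ∀ i, h i q = 0 := by
      have : q ∈ (O ∩ S) ∩ U5 := ⟨⟨hqW.2, hqS⟩, hqU5⟩
      rw [hhS] at this
      exact this.2
    have hhb : ∀ x ∈ U5, (∀ i, h i x = 0) → x ∈ S := by
      intro x h1 h2
      have : x ∈ (O ∩ S) ∩ U5 := by rw [hhS]; exact ⟨h1, h2⟩
      exact this.1.2
    have hg1 : ∀ᶠ x in 𝓝 q, (∀ i, f i x = 0) → ∀ i, h i x = 0 := by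
      refine germ hk (fun i => IsC1H.sdiff hU5 (hh i) hqU5)
        (fun i => IsC1H.sdiff hWo (hfW i) hqW)
        (fun i => (hh i).contOn.continuousAt (hU5.mem_nhds hqU5)) (hhind q hqU5)
        (hfind q hqW.1.1.2) hqh ?_
      filter_upwards [hWo.mem_nhds hqW, hU5.mem_nhds hqU5] with x hx hx5 hhx
      exact hclf x hx.1.1.1 hx.1.1.2 (subset_closure (hhb x hx5 hhx))
    filter_upwards [hg1, hU5.mem_nhds hqU5] with x hx hx5 hfx
    exact hhb x hx5 (hx hfx)
  have hmono : ∀ {g : Hpt n → ℝ}, IsC1H W g → IsC1H U4 g := fun hg => isC1H_mono hg h4W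
  obtain ⟨B1, hB1, hpB1, hB1U, hs1⟩ := side hm hU4 hpU4 (fun i => hmono (hfW i)) (hmono hgW) hi1
    hfp (hGp j) hloc (fun x hx hpos hxb =>
      hpos.ne' (hbG x (h4W hx).1.2 (h4W hx).2 hxb j))
  obtain ⟨B2, hB2, hpB2, hB2U, hs2⟩ := side hm hU4 hpU4 (fun i => hmono (hfW i)) (hmono hgW') hi2
    hfp (by rw [hGp j, neg_zero]) hloc (fun x hx hpos hxb =>
      hpos.ne' (by rw [hbG x (h4W hx).1.2 (h4W hx).2 hxb j, neg_zero]))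
  have hBo : IsOpen (B1 ∩ B2) := hB1.inter hB2
  have hpB : p ∈ B1 ∩ B2 := ⟨hpB1, hpB2⟩
  have hB4 : B1 ∩ B2 ⊆ U4 := fun x hx => hB1U hx.1
  have hSf : ∀ x ∈ B1 ∩ B2, x ∈ S → ∀ i, f i x = 0 := fun x hx hxS =>
    hclf x (h4W (hB4 hx)).1.1.1 (h4W (hB4 hx)).1.1.2 (subset_closure hxS)
  have mk : ∀ g : Hpt n → ℝ, IsC1H W g →
      (∀ x ∈ U4, LinearIndependent ℝ (fun i => gradH (app f g i) x)) →
      (∀ x ∈ B1 ∩ B2, (∀ i, f i x = 0) → 0 < g x → x ∈ S) →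
      (∀ x ∈ B1 ∩ B2, (∀ i, f i x = 0) → g x < 0 → x ∉ S) →
      (∀ x, g x = 0 → G j x = 0) → g p = 0 → IsBdryFrame k S p (B1 ∩ B2) (app f g) := by
    intro g hg hgi hpos hneg hz hgp
    refine ⟨hBo, hpB, fun i => app_all (P := IsC1H (B1 ∩ B2))
      (fun i => isC1H_mono (hfW i) fun x hx => h4W (hB4 hx))
      (isC1H_mono hg fun x hx => h4W (hB4 hx)) i, fun x hx => hgi x (hB4 hx), ?_, ?_⟩
    · simp only [app_castSucc, app_last]
      ext x
      constructor
      · rintro ⟨hxB, hxS⟩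
        have hfx := hSf x hxB hxS
        refine ⟨hxB, hfx, ?_⟩
        rcases lt_trichotomy (g x) 0 with h | h | h
        · exact absurd hxS (hneg x hxB hfx h)
        · exact absurd hxS (h4g x (hB4 hxB) hfx (hz x h)).2
        · exact h
      · rintro ⟨hxB, hfx, hgx⟩
        exact ⟨hxB, hpos x hxB hfx hgx⟩
    · rw [app_last]; exact hgp
  rcases hs1 with hs1 | hs1 <;> rcases hs2 with hs2 | hs2
  · exfalso
    obtain ⟨r, hr, hrB⟩ := hball_small hn D p (hBo.mem_nhds hpB)
    obtain ⟨x, hxr, hxS', hxc⟩ := hball r hr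
    have hxB := hrB hxr
    have hfx : ∀ i, f i x = 0 := by
      have : x ∈ S' ∩ U2 := ⟨hxS', (h4W (hB4 hxB)).1.1.2⟩
      rw [hfS] at this
      exact this.2
    apply hxc
    rcases lt_trichotomy (G j x) 0 with h | h | h
    · exact subset_closure (hs2 x hxB.2 hfx (by linarith))
    · exact (h4g x (hB4 hxB) hfx h).1
    · exact subset_closure (hs1 x hxB.1 hfx h)
  · exact ⟨_, _, mk (G j) hgW (fun x hx => (hU4s _ hx).2.2.1) (fun x hx => hs1 x hx.1)
      (fun x hx hfx h => hs2 x hx.2 hfx (by linarith)) (fun x h => h) (hGp j)⟩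
  · exact ⟨_, _, mk (fun x => -G j x) hgW' (fun x hx => (hU4s _ hx).2.2.2) (fun x hx => hs2 x hx.2)
      (fun x hx hfx h => hs1 x hx.1 hfx (by linarith)) (fun x h => by linarith)
      (by rw [hGp j, neg_zero])⟩
  · exfalso
    obtain ⟨x, hxB, hxS⟩ := mem_closure_iff.1 hp.2.1 _ hBo hpB
    have hfx := hSf x hxB hxS
    rcases lt_trichotomy (G j x) 0 with h | h | h
    · exact hs2 x hxB.2 hfx (by linarith) hxS
    · exact (h4g x (hB4 hxB) hfx h).2 hxS
    · exact hs1 x hxB.1 hfx h hxS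

/-- **Existence and uniqueness of the unit outward normal to the boundary** (Lemma 3.12): if
`1 ≤ k ≤ n−1` and `S` is a `k`-codimensional `C¹_ℍ`-regular submanifold with boundary in `O`,
then there is a unique continuous unit outward-pointing vector field `ν_{∂S}` along
`O ∩ ∂S` with `ν_{∂S}(p) ∈ T^ℍ_pS` and `ν_{∂S}(p) ⊥ T^ℍ_p∂S` for all `p ∈ O ∩ ∂S`. -/
theorem outward_normal_exists_unique {n : ℕ} (hn : 1 ≤ n) (D : HomDist n)
    (k : ℕ) (hk1 : 1 ≤ k) (hk2 : k ≤ n - 1)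
    (O : Set (Hpt n)) (hO : IsOpen O) (S : Set (Hpt n)) (hSO : S ⊆ O)
    (hS : IsC1HSubWithBdry D k O S) :
    ∃ ν : Hpt n → Hpt n, IsUnitOutwardNormal k O S ν ∧
      ∀ ν' : Hpt n → Hpt n, IsUnitOutwardNormal k O S ν' → Set.EqOn ν' ν (O ∩ bdry S) := by
  exact main_of_frames (by omega) fun p hp => frame_exists hn D (by omega) hO hS p hp

end Heis
end
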